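/- arXiv:1410.1380 — 3 statements merged into one kernel-verified Lean document; each statement's English description precedes it below -/
import Mathlib

section
/- There exists a family (d_x), indexed by x ∈ 2^ℕ (functions from ℕ to {0,1}), of bi-invariant metrics on the free group F₃ on three generators, such that: (i) each d_x is discrete, i.e. there is a constant c > 0 with d_x(a, b) ≥ c for all a ≠ b in F₃; and (ii) for all x ≠ y in 2^ℕ there exists g ∈ F₃ with |d_x(g, 1) − d_y(g, 1)| ≥ |g| / 6, where |g| denotes the length of the reduced word representing g. In particular, there are continuum many pairwise distinct such metrics, any two of which are at distance at least 1/6 in the distance dist between metrics. -/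
/-- `d : α → α → ℝ` is a metric on `α`. -/
def IsMetricFun {α : Type*} (d : α → α → ℝ) : Prop :=
  (∀ x y, d x y = 0 ↔ x = y) ∧ (∀ x y, d x y = d y x) ∧
    ∀ x y z, d x z ≤ d x y + d y z

/-- `d` is a bi-invariant metric on the group `G`. -/
def IsBiInvMetric {G : Type*} [Group G] (d : G → G → ℝ) : Prop :=
  IsMetricFun d ∧ (∀ g x y : G, d (g * x) (g * y) = d x y) ∧
    ∀ g x y : G, d (x * g) (y * g) = d x y

open Quaternion in
/-- The quaternion `1 + k`, conjugation by which sends `i` to `j`. -/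
noncomputable def qU : ℍ[ℝ] := ⟨1, 0, 0, 1⟩

open Quaternion in
/-- The unit quaternion `exp (i π / (2 k))`, `k = 10 ^ n`. -/
noncomputable def qA (n : ℕ) : ℍ[ℝ] :=
  Quaternion.ofComplex (Complex.exp (Complex.I * ((Real.pi / 2 / 10 ^ n : ℝ) : ℂ)))

theorem qU_ne : qU ≠ 0 := by
  intro h
  have : (1 : ℝ) = 0 := congrArg (fun q : Quaternion ℝ => q.re) h
  norm_num at this

/-- The quaternion `i`. -/
noncomputable def qI : Quaternion ℝ := ⟨0, 1, 0, 0⟩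

/-- The quaternion `j`. -/
noncomputable def qJ : Quaternion ℝ := ⟨0, 0, 1, 0⟩

theorem qI_ne : qI ≠ 0 := by
  intro h
  have : (1 : ℝ) = 0 := congrArg (fun q : Quaternion ℝ => q.imI) h
  norm_num at this

theorem qJ_ne : qJ ≠ 0 := by
  intro h
  have : (1 : ℝ) = 0 := congrArg (fun q : Quaternion ℝ => q.imJ) h
  norm_num at this

theorem qUI : qU * qI = qJ * qU := by
  ext <;> simp only [Quaternion.re_mul, Quaternion.imI_mul, Quaternion.imJ_mul, Quaternion.imK_mul] <;>
    simp [qU, qI, qJ]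

theorem qIJ : qI * qJ = -1 * qJ * qI := by
  rw [neg_one_mul, neg_mul]
  ext <;> simp only [Quaternion.re_neg, Quaternion.imI_neg, Quaternion.imJ_neg, Quaternion.imK_neg,
    Quaternion.re_mul, Quaternion.imI_mul, Quaternion.imJ_mul, Quaternion.imK_mul] <;>
    simp [qI, qJ]

theorem qOfC_norm (z : ℂ) : ‖Quaternion.ofComplex z‖ = ‖z‖ := by
  rw [Quaternion.coe_ofComplex, ← sq_eq_sq₀ (norm_nonneg _) (norm_nonneg _), sq, sq,
    ← Quaternion.normSq_eq_norm_mul_self, Quaternion.normSq_def', ← sq, Complex.sq_norm,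
    Complex.normSq_apply]
  simp
  ring

theorem qA_norm (n : ℕ) : ‖qA n‖ = 1 := by
  rw [qA, qOfC_norm, mul_comm, Complex.norm_exp_ofReal_mul_I]

theorem qA_ne (n : ℕ) : qA n ≠ 0 := by
  intro h
  have := qA_norm n
  rw [h, norm_zero] at this
  norm_num at this

theorem qA_sub (n : ℕ) : ‖qA n - 1‖ ≤ Real.pi / 2 / 10 ^ n := by
  have h1 : qA n - 1 = Quaternion.ofComplex
      (Complex.exp (Complex.I * ((Real.pi / 2 / 10 ^ n : ℝ) : ℂ)) - 1) := by
    rw [map_sub, map_one, qA]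
  rw [h1, qOfC_norm]
  refine (Real.norm_exp_I_mul_ofReal_sub_one_le).trans ?_
  rw [Real.norm_eq_abs, abs_of_nonneg]
  positivity

theorem qA_pow (n : ℕ) : qA n ^ (10 ^ n) = qI := by
  rw [qA, ← map_pow, ← Complex.exp_nat_mul]
  have : ((10 ^ n : ℕ) : ℂ) * (Complex.I * ((Real.pi / 2 / 10 ^ n : ℝ) : ℂ))
      = (Real.pi : ℂ) / 2 * Complex.I := by
    push_cast
    field_simp
  rw [this, Complex.exp_pi_div_two_mul_I]
  rw [Quaternion.coe_ofComplex]
  ext <;> simp [qI]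

/-- The images of the generators. -/
noncomputable def qGen (n : ℕ) (i : Fin 3) : (Quaternion ℝ)ˣ :=
  if i = 0 then Units.mk0 (qA n) (qA_ne n)
  else if i = 1 then Units.mk0 qU qU_ne * Units.mk0 (qA n) (qA_ne n) * (Units.mk0 qU qU_ne)⁻¹
  else 1

/-- The representation of the free group in the unit quaternions. -/
noncomputable def qRho (n : ℕ) : FreeGroup (Fin 3) →* (Quaternion ℝ)ˣ :=
  FreeGroup.lift (qGen n)

theorem qGen_norm (n : ℕ) (i : Fin 3) : ‖(qGen n i : Quaternion ℝ)‖ = 1 := by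
  have h := norm_ne_zero_iff.2 qU_ne
  unfold qGen
  split_ifs
  · simp [qA_norm]
  · simp only [Units.val_mul, Units.val_mk0, norm_mul, qA_norm, Units.val_inv_eq_inv_val, norm_inv]
    field_simp
  · simp

theorem qGen_sub (n : ℕ) (i : Fin 3) :
    ‖(qGen n i : Quaternion ℝ) - 1‖ ≤ Real.pi / 2 / 10 ^ n := by
  have h := norm_ne_zero_iff.2 qU_ne
  unfold qGen
  split_ifs
  · simpa using qA_sub n
  · have h2 : qU * qA n * qU⁻¹ - 1 = qU * (qA n - 1) * qU⁻¹ := by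
      rw [mul_sub, sub_mul, mul_one, mul_inv_cancel₀ qU_ne]
    simp only [Units.val_mul, Units.val_mk0, Units.val_inv_eq_inv_val]
    rw [h2, norm_mul, norm_mul, norm_inv]
    have : ‖qU‖ * ‖qA n - 1‖ * ‖qU‖⁻¹ = ‖qA n - 1‖ := by field_simp
    rw [this]
    exact qA_sub n
  · simp
    positivity

theorem qRho_norm (n : ℕ) (g : FreeGroup (Fin 3)) : ‖(qRho n g : Quaternion ℝ)‖ = 1 := by
  induction g using FreeGroup.induction_on with
  | C1 => simp
  | of i => simpa [qRho] using qGen_norm n i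
  | inv_of i h => simp only [map_inv, Units.val_inv_eq_inv_val, norm_inv, h, inv_one]
  | mul x y hx hy => rw [map_mul, Units.val_mul, norm_mul, hx, hy, one_mul]

theorem qRho_left (n : ℕ) (g x y : FreeGroup (Fin 3)) :
    ‖(qRho n (g * x) : Quaternion ℝ) - qRho n (g * y)‖ = ‖(qRho n x : Quaternion ℝ) - qRho n y‖ := by
  rw [map_mul, map_mul, Units.val_mul, Units.val_mul, ← mul_sub, norm_mul, qRho_norm, one_mul]

theorem qRho_right (n : ℕ) (g x y : FreeGroup (Fin 3)) :
    ‖(qRho n (x * g) : Quaternion ℝ) - qRho n (y * g)‖ = ‖(qRho n x : Quaternion ℝ) - qRho n y‖ := by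
  rw [map_mul, map_mul, Units.val_mul, Units.val_mul, ← sub_mul, norm_mul, qRho_norm, mul_one]

theorem qRho_mul_sub (n : ℕ) (x y : FreeGroup (Fin 3)) :
    ‖(qRho n (x * y) : Quaternion ℝ) - 1‖ ≤
      ‖(qRho n x : Quaternion ℝ) - 1‖ + ‖(qRho n y : Quaternion ℝ) - 1‖ := by
  have h := qRho_right n y x 1
  simp only [one_mul, map_one, Units.val_one] at h
  calc _ ≤ ‖(qRho n (x * y) : Quaternion ℝ) - qRho n y‖ + ‖(qRho n y : Quaternion ℝ) - 1‖ :=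
        norm_sub_le_norm_sub_add_norm_sub _ _ _
    _ = _ := by rw [h]

theorem qRho_inv_sub (n : ℕ) (x : FreeGroup (Fin 3)) :
    ‖(qRho n x⁻¹ : Quaternion ℝ) - 1‖ = ‖(qRho n x : Quaternion ℝ) - 1‖ := by
  have h := qRho_left n x x⁻¹ 1
  simp only [mul_one, mul_inv_cancel, map_one, Units.val_one] at h
  rw [← h, norm_sub_rev]

theorem qRho_bdd (g : FreeGroup (Fin 3)) :
    ∃ B : ℝ, ∀ n, (10 : ℝ) ^ n * ‖(qRho n g : Quaternion ℝ) - 1‖ ≤ B := by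
  induction g using FreeGroup.induction_on with
  | C1 => exact ⟨0, fun n => by simp⟩
  | of i =>
    refine ⟨Real.pi / 2, fun n => ?_⟩
    have h := qGen_sub n i
    rw [le_div_iff₀ (by positivity)] at h
    simpa [qRho, mul_comm] using h
  | inv_of i h =>
    obtain ⟨B, hB⟩ := h
    exact ⟨B, fun n => by rw [qRho_inv_sub]; exact hB n⟩
  | mul x y hx hy =>
    obtain ⟨B, hB⟩ := hx
    obtain ⟨C, hC⟩ := hy
    refine ⟨B + C, fun n => ?_⟩
    calc _ ≤ (10 : ℝ) ^ n * (‖(qRho n x : Quaternion ℝ) - 1‖ + ‖(qRho n y : Quaternion ℝ) - 1‖) := by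
          gcongr
          exact qRho_mul_sub n x y
      _ ≤ B + C := by rw [mul_add]; exact add_le_add (hB n) (hC n)

/-- The scaled pseudometric at scale `10 ^ n`. -/
noncomputable def qTerm (x : ℕ → Bool) (g h : FreeGroup (Fin 3)) (n : ℕ) : ℝ :=
  if x n then (10 : ℝ) ^ n * ‖(qRho n g : Quaternion ℝ) - qRho n h‖ else 0

theorem qTerm_nonneg (x : ℕ → Bool) (g h : FreeGroup (Fin 3)) (n : ℕ) : 0 ≤ qTerm x g h n := by
  unfold qTerm
  split_ifs <;> positivity

theorem qTerm_bdd (x : ℕ → Bool) (g h : FreeGroup (Fin 3)) :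
    BddAbove (Set.range (qTerm x g h)) := by
  obtain ⟨B, hB⟩ := qRho_bdd (h⁻¹ * g)
  refine ⟨B, ?_⟩
  rintro _ ⟨n, rfl⟩
  have h0 := hB n
  have h1 := qRho_left n h⁻¹ g h
  simp only [inv_mul_cancel, map_one, Units.val_one] at h1
  rw [h1] at h0
  unfold qTerm
  split_ifs
  · exact h0
  · exact le_trans (by positivity) h0

/-- The supremum pseudometric. -/
noncomputable def qSup (x : ℕ → Bool) (g h : FreeGroup (Fin 3)) : ℝ := ⨆ n, qTerm x g h n

theorem qSup_nonneg (x : ℕ → Bool) (g h : FreeGroup (Fin 3)) : 0 ≤ qSup x g h :=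
  Real.iSup_nonneg (qTerm_nonneg x g h)

open Classical in
/-- The metrics. -/
noncomputable def qDist (x : ℕ → Bool) (g h : FreeGroup (Fin 3)) : ℝ :=
  (if g = h then 0 else 1) + qSup x g h

theorem qDist_biInv (x : ℕ → Bool) : IsBiInvMetric (qDist x) := by
  refine ⟨⟨?_, ?_, ?_⟩, ?_, ?_⟩
  · intro g h
    constructor
    · intro H
      by_contra hne
      have := qSup_nonneg x g h
      simp only [qDist, hne, if_false] at H
      linarith
    · rintro rfl
      simp [qDist, qSup, qTerm]
  · intro g h
    simp only [qDist, qSup, qTerm, eq_comm (a := g), norm_sub_rev (qRho _ g : Quaternion ℝ)]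
  · intro g h k
    have h1 : qSup x g k ≤ qSup x g h + qSup x h k := by
      refine ciSup_le fun n => ?_
      refine le_trans ?_ (add_le_add (le_ciSup (qTerm_bdd x g h) n) (le_ciSup (qTerm_bdd x h k) n))
      unfold qTerm
      split_ifs
      · rw [← mul_add]
        gcongr
        exact norm_sub_le_norm_sub_add_norm_sub _ _ _
      · simp
    unfold qDist
    by_cases hgh : g = h
    · subst hgh
      rw [if_pos rfl]
      linarith
    · rw [if_neg hgh]
      split_ifs <;> linarith
  · intro g a b
    simp only [qDist, qSup, qTerm, qRho_left, mul_right_inj]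
  · intro g a b
    simp only [qDist, qSup, qTerm, qRho_right, mul_left_inj]

/-- The test elements `[a^k, b^k]`, `k = 10 ^ n`. -/
def qTest (n : ℕ) : FreeGroup (Fin 3) :=
  FreeGroup.of 0 ^ (10 ^ n) * FreeGroup.of 1 ^ (10 ^ n) *
    (FreeGroup.of 0 ^ (10 ^ n))⁻¹ * (FreeGroup.of 1 ^ (10 ^ n))⁻¹

theorem qNorm_pow (i : Fin 3) (k : ℕ) : (FreeGroup.of i ^ k).norm ≤ k := by
  induction k with
  | zero => simp
  | succ k ih =>
    rw [pow_succ]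
    refine (FreeGroup.norm_mul_le _ _).trans ?_
    rw [FreeGroup.norm_of]
    omega

theorem qTest_norm (n : ℕ) : (qTest n).norm ≤ 4 * 10 ^ n := by
  unfold qTest
  have h0 := qNorm_pow 0 (10 ^ n)
  have h1 := qNorm_pow 1 (10 ^ n)
  refine (FreeGroup.norm_mul_le _ _).trans ?_
  refine (Nat.add_le_add_right (FreeGroup.norm_mul_le _ _) _).trans ?_
  refine (Nat.add_le_add_right (Nat.add_le_add_right (FreeGroup.norm_mul_le _ _) _) _).trans ?_
  rw [FreeGroup.norm_inv_eq, FreeGroup.norm_inv_eq]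
  omega

theorem qTest_self (n : ℕ) : (qRho n (qTest n) : Quaternion ℝ) = -1 := by
  have hu : qRho n (FreeGroup.of 0 ^ (10 ^ n)) = Units.mk0 qI qI_ne := by
    ext1
    simp [qRho, qGen, qA_pow]
  have hv : qRho n (FreeGroup.of 1 ^ (10 ^ n)) = Units.mk0 qJ qJ_ne := by
    rw [map_pow, qRho, FreeGroup.lift_apply_of, qGen, if_neg (by decide), if_pos rfl, conj_pow]
    rw [mul_inv_eq_iff_eq_mul]
    ext1
    simp only [Units.val_mul, Units.val_pow_eq_pow_val, Units.val_mk0, qA_pow]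
    exact qUI
  have key : qRho n (qTest n) = -1 := by
    unfold qTest
    rw [map_mul, map_mul, map_mul, map_inv, map_inv, hu, hv]
    rw [mul_inv_eq_iff_eq_mul, mul_inv_eq_iff_eq_mul]
    ext1
    simp only [Units.val_mul, Units.val_mk0, Units.val_neg, Units.val_one]
    exact qIJ
  rw [key]
  simp

theorem qPow_sub (m : ℕ) (i : Fin 3) (k : ℕ) :
    ‖(qRho m (FreeGroup.of i ^ k) : Quaternion ℝ) - 1‖ ≤ k * (Real.pi / 2 / 10 ^ m) := by
  induction k with
  | zero => simp
  | succ k ih =>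
    rw [pow_succ]
    refine (qRho_mul_sub _ _ _).trans ?_
    have : ‖(qRho m (FreeGroup.of i) : Quaternion ℝ) - 1‖ ≤ Real.pi / 2 / 10 ^ m := by
      simpa [qRho] using qGen_sub m i
    push_cast
    linarith

theorem qComm_sub (m : ℕ) (g h : FreeGroup (Fin 3)) :
    ‖(qRho m (g * h * g⁻¹ * h⁻¹) : Quaternion ℝ) - 1‖ ≤
      2 * (‖(qRho m g : Quaternion ℝ) - 1‖ * ‖(qRho m h : Quaternion ℝ) - 1‖) := by
  have h1 := qRho_right m (h * g) (g * h * g⁻¹ * h⁻¹) 1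
  have e : g * h * g⁻¹ * h⁻¹ * (h * g) = g * h := by group
  rw [e, one_mul, map_one, Units.val_one, map_mul, map_mul, Units.val_mul, Units.val_mul] at h1
  rw [← h1]
  generalize (qRho m g : Quaternion ℝ) = p
  generalize (qRho m h : Quaternion ℝ) = q
  have : p * q - q * p = (p - 1) * (q - 1) - (q - 1) * (p - 1) := by noncomm_ring
  rw [this]
  refine (norm_sub_le _ _).trans ?_
  rw [norm_mul, norm_mul]
  linarith [mul_comm ‖p - 1‖ ‖q - 1‖]

theorem qTest_other (m n : ℕ) (hmn : m ≠ n) :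
    (10 : ℝ) ^ m * ‖(qRho m (qTest n) : Quaternion ℝ) - 1‖ ≤ 10 ^ n / 2 := by
  rcases lt_or_gt_of_ne hmn with h | h
  · have h1 : ‖(qRho m (qTest n) : Quaternion ℝ) - 1‖ ≤ 2 := by
      refine (norm_sub_le _ _).trans ?_
      rw [qRho_norm, norm_one]
      norm_num
    have h2 : (10 : ℝ) ^ (m + 1) ≤ 10 ^ n := pow_le_pow_right₀ (by norm_num) h
    rw [pow_succ] at h2
    have h3 : (0 : ℝ) < 10 ^ m := by positivity
    nlinarith
  · have h1 := qComm_sub m (FreeGroup.of 0 ^ (10 ^ n)) (FreeGroup.of 1 ^ (10 ^ n))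
    have h2 := qPow_sub m 0 (10 ^ n)
    have h3 := qPow_sub m 1 (10 ^ n)
    have h4 : (10 : ℝ) ^ (n + 1) ≤ 10 ^ m := pow_le_pow_right₀ (by norm_num) h
    rw [pow_succ] at h4
    push_cast at h2 h3
    have h5 := mul_le_mul h2 h3 (norm_nonneg _) (by positivity)
    have hpi : Real.pi ^ 2 ≤ 10 := by nlinarith [Real.pi_lt_d2, Real.pi_pos]
    change (10 : ℝ) ^ m * ‖(qRho m (_ * _ * _ * _) : Quaternion ℝ) - 1‖ ≤ _
    have hk : (0 : ℝ) < 10 ^ n := by positivity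
    have hK : (0 : ℝ) < 10 ^ m := by positivity
    generalize (10 : ℝ) ^ n = k at *
    generalize (10 : ℝ) ^ m = K at *
    calc _ ≤ K * (2 * (k * (Real.pi / 2 / K) * (k * (Real.pi / 2 / K)))) := by
          gcongr
          linarith
      _ = Real.pi ^ 2 * k ^ 2 / (2 * K) := by
          field_simp
      _ ≤ k / 2 := by
          rw [div_le_div_iff₀ (by positivity) (by norm_num)]
          nlinarith [mul_le_mul_of_nonneg_right hpi (sq_nonneg k), mul_le_mul_of_nonneg_left h4 hk.le]

theorem qSep (x y : ℕ → Bool) (n : ℕ) (hx : x n = true) (hy : y n = false) :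
    (10 : ℝ) ^ n * (3 / 2) ≤ qDist x (qTest n) 1 - qDist y (qTest n) 1 := by
  have h1 : 2 * (10 : ℝ) ^ n ≤ qSup x (qTest n) 1 := by
    refine le_trans ?_ (le_ciSup (qTerm_bdd x (qTest n) 1) n)
    rw [qTerm, if_pos hx, qTest_self, map_one, Units.val_one]
    have : (-1 - 1 : Quaternion ℝ) = -(1 + 1) := by noncomm_ring
    have h2 : ‖(-1 - 1 : Quaternion ℝ)‖ = 2 := by
      rw [this, norm_neg, one_add_one_eq_two]
      have := Quaternion.norm_coe (2 : ℝ)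
      rw [Real.norm_eq_abs, abs_of_pos two_pos] at this
      rw [← this]
      rfl
    rw [h2, mul_comm]
  have h2 : qSup y (qTest n) 1 ≤ 10 ^ n / 2 := by
    refine ciSup_le fun m => ?_
    unfold qTerm
    split_ifs with hm
    · rw [map_one, Units.val_one]
      apply qTest_other
      rintro rfl
      simp [hy] at hm
    · positivity
  unfold qDist
  linarith

theorem qSep' (x y : ℕ → Bool) (hxy : x ≠ y) :
    ∃ g : FreeGroup (Fin 3), g ≠ 1 ∧ (FreeGroup.norm g : ℝ) / 6 ≤ |qDist x g 1 - qDist y g 1| := by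
  obtain ⟨n, hn⟩ := Function.ne_iff.1 hxy
  refine ⟨qTest n, ?_, ?_⟩
  · intro h
    have h1 := qTest_self n
    rw [h, map_one, Units.val_one] at h1
    have h2 : (1 : ℝ) = -1 := congrArg (fun q : Quaternion ℝ => q.re) h1
    norm_num at h2
  · have h1 : ((qTest n).norm : ℝ) ≤ 4 * 10 ^ n := by exact_mod_cast qTest_norm n
    have h2 : (0 : ℝ) < 10 ^ n := by positivity
    cases hx : x n <;> cases hy : y n
    · simp [hx, hy] at hn
    · have := qSep y x n hy hx
      rw [abs_sub_comm]
      exact le_trans (by linarith) (le_abs_self _)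
    · have := qSep x y n hx hy
      exact le_trans (by linarith) (le_abs_self _)
    · simp [hx, hy] at hn

/-- There is a family, indexed by `x ∈ 2^ℕ`, of discrete bi-invariant metrics
on the free group `F₃` such that for distinct indices `x ≠ y` there is a nontrivial `g ∈ F₃`
with `|d_x(g,1) - d_y(g,1)| ≥ |g|/6`; in particular the family is injective, so there are
continuum many such metrics, pairwise at `dist`-distance at least `1/6`. -/
theorem exists_continuum_many_far_discrete_biinv_metrics :
    ∃ d : (ℕ → Bool) → FreeGroup (Fin 3) → FreeGroup (Fin 3) → ℝ,
      (∀ x, IsBiInvMetric (d x)) ∧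
      (∀ x, ∃ c : ℝ, 0 < c ∧ ∀ a b : FreeGroup (Fin 3), a ≠ b → c ≤ d x a b) ∧
      (∀ x y : ℕ → Bool, x ≠ y →
        ∃ g : FreeGroup (Fin 3), g ≠ 1 ∧
          (FreeGroup.norm g : ℝ) / 6 ≤ |d x g 1 - d y g 1|) ∧
      Function.Injective d := by
  refine ⟨qDist, qDist_biInv, ?_, qSep', ?_⟩
  · intro x
    refine ⟨1, one_pos, fun a b hab => ?_⟩
    have := qSup_nonneg x a b
    simp only [qDist, hab, if_false]
    linarith
  · intro x y h
    by_contra hxy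
    obtain ⟨g, hg, hle⟩ := qSep' x y hxy
    rw [h, sub_self, abs_zero] at hle
    have h1 : g.norm ≠ 0 := fun h0 => hg (FreeGroup.norm_eq_zero.1 h0)
    have h2 : (0 : ℝ) < g.norm := by exact_mod_cast Nat.pos_of_ne_zero h1
    linarith
end

section
/- Let D be the Polish space of all bi-invariant metrics bounded by 1 on the free group F_∞ on countably many generators, viewed as a subspace of [0,1]^{F_∞ × F_∞} with the product topology. Then there exists a comeager subset S of D such that any two metrics in S have isometrically isomorphic completions; precisely, for all d₁, d₂ ∈ S there exist a group H with a complete bi-invariant metric δ and isometric group monomorphisms φ₁ : (F_∞, d₁) → (H, δ) and φ₂ : (F_∞, d₂) → (H, δ), each with dense image. -/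
/-- The metric of the metric space `G` is bi-invariant with respect to the group structure. -/
def BiInvariantDist (G : Type*) [Group G] [MetricSpace G] : Prop :=
  ∀ g x y : G, dist (g * x) (g * y) = dist x y ∧ dist (x * g) (y * g) = dist x y


namespace BiInvGen

abbrev F := FreeGroup ℕ
abbrev GG := FreeGroup (Bool × ℕ)

/-- Conjugation-invariant pseudonorm bounded by `1`. -/
structure PN {G : Type*} [Group G] (N : G → ℝ) : Prop where
  one : N 1 = 0
  inv : ∀ g, N g⁻¹ = N g
  mul : ∀ g h, N (g * h) ≤ N g + N h
  conj : ∀ g h, N (h * g * h⁻¹) = N g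
  nonneg : ∀ g, 0 ≤ N g
  le_one : ∀ g, N g ≤ 1

lemma PN.conj' {G : Type*} [Group G] {N : G → ℝ} (hN : PN N) (g h : G) :
    N (h⁻¹ * g * h) = N g := by
  have := hN.conj g h⁻¹
  rwa [inv_inv] at this

lemma PN.tri {G : Type*} [Group G] {N : G → ℝ} (hN : PN N) (x y z : G) :
    N (x⁻¹ * z) ≤ N (x⁻¹ * y) + N (y⁻¹ * z) := by
  have := hN.mul (x⁻¹ * y) (y⁻¹ * z)
  simpa [mul_assoc] using this

lemma PN.symm {G : Type*} [Group G] {N : G → ℝ} (hN : PN N) (x y : G) :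
    N (x⁻¹ * y) = N (y⁻¹ * x) := by
  have := hN.inv (x⁻¹ * y)
  simpa using this.symm

lemma PN.left {G : Type*} [Group G] {N : G → ℝ} (_hN : PN N) (g x y : G) :
    N ((g * x)⁻¹ * (g * y)) = N (x⁻¹ * y) := by
  congr 1; group

lemma PN.right {G : Type*} [Group G] {N : G → ℝ} (hN : PN N) (g x y : G) :
    N ((x * g)⁻¹ * (y * g)) = N (x⁻¹ * y) := by
  rw [← hN.conj' (x⁻¹ * y) g]; congr 1; group

lemma PN.mul2 {G : Type*} [Group G] {N : G → ℝ} (hN : PN N) (x y x' y' : G) :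
    N ((x * y)⁻¹ * (x' * y')) ≤ N (x⁻¹ * x') + N (y⁻¹ * y') := by
  have h := hN.tri (x * y) (x' * y) (x' * y')
  rw [hN.left, hN.right] at h
  exact h

lemma PN.inv2 {G : Type*} [Group G] {N : G → ℝ} (hN : PN N) (x y : G) :
    N ((x⁻¹)⁻¹ * y⁻¹) = N (x⁻¹ * y) := by
  rw [hN.symm x y, ← hN.conj' ((x⁻¹)⁻¹ * y⁻¹) x]; congr 1; group

lemma PN.abs_sub {G : Type*} [Group G] {N : G → ℝ} (hN : PN N) (x y : G) :
    |N x - N y| ≤ N (x⁻¹ * y) := by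
  have h1 := hN.tri 1 x y
  have h2 := hN.tri 1 y x
  rw [hN.symm y x] at h2
  simp only [inv_one, one_mul] at h1 h2
  rw [abs_le]; constructor <;> linarith

/-- Build a pseudonorm from a cost relation. -/
lemma exists_PN {G : Type*} [Group G] (P : G → ℝ → Prop)
    (h0 : ∀ x c, P x c → 0 ≤ c) (hb : ∀ x, P x 1) (h1 : P 1 0)
    (hinv : ∀ x c, P x c → P x⁻¹ c)
    (hmul : ∀ x c y d, P x c → P y d → P (x * y) (c + d))
    (hconj : ∀ x c y, P x c → P (y * x * y⁻¹) c) :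
    ∃ N : G → ℝ, PN N ∧ (∀ x c, P x c → N x ≤ c) ∧
      ∀ x r, (∀ c, P x c → r ≤ c) → r ≤ N x := by
  have up : ∀ x c, P x c → sInf {c | P x c} ≤ c := fun x c h =>
    csInf_le ⟨0, fun c hc => h0 x c hc⟩ h
  have lo : ∀ x r, (∀ c, P x c → r ≤ c) → r ≤ sInf {c | P x c} := fun x r h =>
    le_csInf ⟨1, hb x⟩ h
  refine ⟨fun x => sInf {c | P x c}, ⟨?_, ?_, ?_, ?_, ?_, ?_⟩, up, lo⟩
  · exact le_antisymm (up _ _ h1) (lo _ _ (h0 1))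
  · intro g
    refine le_antisymm (lo _ _ fun c hc => up _ _ (hinv _ _ hc)) (lo _ _ fun c hc => up _ _ ?_)
    simpa using hinv _ _ hc
  · intro g h
    have : sInf {c | P (g * h) c} - sInf {c | P h c} ≤ sInf {c | P g c} := by
      refine lo _ _ fun c hc => ?_
      have : sInf {c | P (g * h) c} - c ≤ sInf {c | P h c} :=
        lo _ _ fun d hd => by linarith [up _ _ (hmul _ _ _ _ hc hd)]
      linarith
    show sInf {c | P (g * h) c} ≤ sInf {c | P g c} + sInf {c | P h c}
    linarith
  · intro g h
    refine le_antisymm (lo _ _ fun c hc => up _ _ (hconj _ _ _ hc))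
      (lo _ _ fun c hc => up _ _ ?_)
    have := hconj _ _ h⁻¹ hc
    convert this using 1; group
  · intro g; exact lo _ _ (h0 g)
  · intro g; exact up _ _ (hb g)

section amalgam

/-- Planar derivations: `T i w g c` says that the word `w` can be evaluated on side `i` to the
element `g` at cost `c`. -/
inductive T (N : Bool → F → ℝ) {A : Type} [Group A] (α : Bool → A →* F) (l : A → ℝ) :
    Bool → List ((Bool × ℕ) × Bool) → F → ℝ → Prop
  | nil (i : Bool) : T N α l i [] 1 0
  | letter (i : Bool) (n : ℕ) (s : Bool) : T N α l i [((i, n), s)] (FreeGroup.mk [(n, s)]) 0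
  | mul (i : Bool) (w w' : List ((Bool × ℕ) × Bool)) (g g' : F) (c c' : ℝ) :
      T N α l i w g c → T N α l i w' g' c' → T N α l i (w ++ w') (g * g') (c + c')
  | slack (i : Bool) (w : List ((Bool × ℕ) × Bool)) (g g' : F) (c c' : ℝ) :
      T N α l i w g c → c + N i (g⁻¹ * g') ≤ c' → T N α l i w g' c'
  | switch (i : Bool) (w : List ((Bool × ℕ) × Bool)) (s : A) (c : ℝ) :
      T N α l (!i) w (α (!i) s) c → T N α l i w (α i s) (c + l s)

variable {N : Bool → F → ℝ} {A : Type} [Group A] {α : Bool → A →* F} {l : A → ℝ}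

/-- The hypotheses of the amalgamation lemma. -/
structure Hyp (N : Bool → F → ℝ) {A : Type} [Group A] (α : Bool → A →* F) (l : A → ℝ) : Prop where
  pn : ∀ i, PN (N i)
  l1 : l 1 = 0
  l0 : ∀ s, 0 ≤ l s
  linv : ∀ s, l s⁻¹ = l s
  lmul : ∀ s t, l (s * t) ≤ l s + l t
  close : ∀ i s, N i (α i s) ≤ N (!i) (α (!i) s) + l s

lemma T.cast {i : Bool} {w w' : List ((Bool × ℕ) × Bool)} {g g' : F} {c c' : ℝ} (H : Hyp N α l)
    (h : T N α l i w g c) (hw : w = w') (hg : g = g') (hc : c ≤ c') : T N α l i w' g' c' := by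
  subst hw; subst hg
  exact T.slack _ _ g _ c _ h (by simp [(H.pn i).one, hc])

lemma T.nonneg {i : Bool} {w : List ((Bool × ℕ) × Bool)} {g : F} {c : ℝ} (H : Hyp N α l)
    (h : T N α l i w g c) : 0 ≤ c := by
  induction h with
  | nil => exact le_rfl
  | letter => exact le_rfl
  | mul _ _ _ _ _ _ _ _ _ h1 h2 => linarith
  | slack i w g g' c c' _ h ih => linarith [(H.pn i).nonneg (g⁻¹ * g')]
  | switch i w s c _ ih => linarith [H.l0 s]

lemma T.sound {i : Bool} {w : List ((Bool × ℕ) × Bool)} {g : F} {c : ℝ} (H : Hyp N α l)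
    (h : T N α l i w g c) : ∀ (k : Bool) (L : List (ℕ × Bool)),
      w = L.map (fun p => ((k, p.1), p.2)) →
      (i = k → N k ((FreeGroup.mk L)⁻¹ * g) ≤ c) ∧
      (i = !k → ∃ s, N k ((FreeGroup.mk L)⁻¹ * α k s) + l s + N i ((α i s)⁻¹ * g) ≤ c) := by
  induction h with
  | nil i =>
    intro k L hL
    have : L = [] := by simpa using hL.symm
    subst this
    have e : (FreeGroup.mk [] : F) = 1 := rfl
    refine ⟨fun _ => by simp [e, (H.pn k).one], fun _ => ⟨1, by simp [e, (H.pn _).one, H.l1]⟩⟩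
  | letter i n s =>
    intro k L hL
    obtain ⟨p, rfl, hp⟩ : ∃ p, L = [p] ∧ ((k, p.1), p.2) = ((i, n), s) := by
      match L, hL with
      | [p], hL => exact ⟨p, rfl, by simpa using hL.symm⟩
    obtain ⟨n', s'⟩ := p
    simp only [Prod.mk.injEq] at hp
    obtain ⟨⟨rfl, rfl⟩, rfl⟩ := hp
    refine ⟨fun _ => by simp only [inv_mul_cancel, (H.pn _).one, le_refl], fun h => ?_⟩
    exact absurd h (by cases k <;> simp)
  | mul i w w' g g' c c' _ _ ih1 ih2 =>
    intro k L hL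
    obtain ⟨L1, L2, rfl, h1, h2⟩ := List.map_eq_append_iff.1 hL.symm
    have e : (FreeGroup.mk (L1 ++ L2) : F) = FreeGroup.mk L1 * FreeGroup.mk L2 := by
      simp
    rw [e]
    obtain ⟨a1, b1⟩ := ih1 k L1 h1.symm
    obtain ⟨a2, b2⟩ := ih2 k L2 h2.symm
    constructor
    · intro hi
      linarith [a1 hi, a2 hi, (H.pn k).mul2 (FreeGroup.mk L1) (FreeGroup.mk L2) g g']
    · intro hi
      obtain ⟨s, hs⟩ := b1 hi
      obtain ⟨t, ht⟩ := b2 hi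
      refine ⟨s * t, ?_⟩
      rw [map_mul, map_mul]
      linarith [(H.pn k).mul2 (FreeGroup.mk L1) (FreeGroup.mk L2) (α k s) (α k t), H.lmul s t,
        (H.pn i).mul2 (α i s) (α i t) g g']
  | slack i w g g' c c' _ h ih =>
    intro k L hL
    obtain ⟨a, b⟩ := ih k L hL
    constructor
    · intro hi
      subst hi
      linarith [a rfl, (H.pn i).tri (FreeGroup.mk L) g g']
    · intro hi
      obtain ⟨s, hs⟩ := b hi
      exact ⟨s, by linarith [(H.pn i).tri (α i s) g g']⟩
  | switch i w s c _ ih =>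
    intro k L hL
    obtain ⟨a, b⟩ := ih k L hL
    constructor
    · intro hi
      subst hi
      obtain ⟨t, ht⟩ := b rfl
      have h1 := (H.pn i).tri (FreeGroup.mk L) (α i t) (α i s)
      have h2 := H.close i (t⁻¹ * s)
      simp only [map_mul, map_inv] at h2
      have h3 := H.lmul t⁻¹ s
      rw [H.linv] at h3
      linarith
    · intro hi
      subst hi
      have := a (by simp)
      refine ⟨s, ?_⟩
      simp only [Bool.not_not] at this
      rw [inv_mul_cancel, (H.pn _).one]
      linarith

lemma T.extract {i : Bool} {w' : List ((Bool × ℕ) × Bool)} {g : F} {c : ℝ} (H : Hyp N α l)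
    (h : T N α l i w' g c) : ∀ (j : Bool) (n : ℕ) (b : Bool) (w : List ((Bool × ℕ) × Bool)),
      w' = ((j, n), b) :: w →
      (j = i → T N α l i w ((FreeGroup.mk [(n, b)])⁻¹ * g) c) ∧
      (j = !i → ∃ s w1 w2 c1 c2, w = w1 ++ w2 ∧
        T N α l j w1 ((FreeGroup.mk [(n, b)])⁻¹ * α j s) c1 ∧
        T N α l i w2 ((α i s)⁻¹ * g) c2 ∧ c1 + c2 + l s ≤ c) := by
  induction h with
  | nil i => intro j n b w h; simp at h
  | letter i n s =>
    intro j n' b w h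
    simp only [List.cons.injEq, Prod.mk.injEq] at h
    obtain ⟨⟨⟨rfl, rfl⟩, rfl⟩, rfl⟩ := h
    refine ⟨fun _ => ?_, fun h => absurd h (by cases i <;> simp)⟩
    rw [inv_mul_cancel]; exact T.nil _
  | mul i w1 w2 g g' c c' h1 h2 ih1 ih2 =>
    intro j n b w h
    rcases w1 with _ | ⟨x, w1⟩
    · have hg : N i g ≤ c := by
        have := (h1.sound H i [] rfl).1 rfl
        have e : (FreeGroup.mk [] : F) = 1 := rfl
        simpa [e] using this
      obtain ⟨p, q⟩ := ih2 j n b w h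
      have key : ∀ x : F, N i ((x * g')⁻¹ * (x * (g * g'))) = N i g := by
        intro x
        rw [(H.pn i).left, ← mul_assoc, (H.pn i).conj']
      constructor
      · intro hj
        exact T.slack _ _ _ _ _ _ (p hj) (by rw [key]; linarith)
      · intro hj
        obtain ⟨s, u1, u2, c1, c2, hw, t1, t2, hc⟩ := q hj
        exact ⟨s, u1, u2, c1, c2 + c, hw, t1,
          T.slack _ _ _ _ _ _ t2 (by rw [key]; linarith), by linarith⟩
    · simp only [List.cons_append, List.cons.injEq] at h
      obtain ⟨rfl, rfl⟩ := h
      obtain ⟨p, q⟩ := ih1 j n b w1 rfl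
      constructor
      · intro hj
        exact (T.mul _ _ _ _ _ _ _ (p hj) h2).cast H rfl (by group) le_rfl
      · intro hj
        obtain ⟨s, u1, u2, c1, c2, hw, t1, t2, hc⟩ := q hj
        exact ⟨s, u1, u2 ++ w2, c1, c2 + c', by simp [hw], t1,
          (T.mul _ _ _ _ _ _ _ t2 h2).cast H rfl (by group) le_rfl, by linarith⟩
  | slack i w g g' c c' _ h ih =>
    intro j n b w h
    obtain ⟨p, q⟩ := ih j n b w h
    constructor
    · intro hj
      exact T.slack _ _ _ _ _ _ (p hj) (by rw [(H.pn i).left]; linarith)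
    · intro hj
      obtain ⟨s, u1, u2, c1, c2, hw, t1, t2, hc⟩ := q hj
      exact ⟨s, u1, u2, c1, c2 + N i (g⁻¹ * g'), hw, t1,
        T.slack _ _ _ _ _ _ t2 (by rw [(H.pn i).left]), by linarith⟩
  | switch i w s c _ ih =>
    intro j n b w h
    obtain ⟨p, q⟩ := ih j n b w h
    constructor
    · intro hj
      subst hj
      obtain ⟨t, u1, u2, c1, c2, hw, t1, t2, hc⟩ := q (by simp)
      have t3 := T.switch j u2 (t⁻¹ * s) c2 (t2.cast H rfl (by simp) le_rfl)
      have h3 := H.lmul t⁻¹ s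
      rw [H.linv] at h3
      exact (T.mul _ _ _ _ _ _ _ t1 t3).cast H hw.symm (by simp [mul_assoc]) (by linarith)
    · intro hj
      subst hj
      refine ⟨s, w, [], c, 0, by simp, p rfl, ?_, by linarith⟩
      rw [inv_mul_cancel]; exact T.nil _

lemma T.side {i : Bool} {w : List ((Bool × ℕ) × Bool)} {c : ℝ} (H : Hyp N α l)
    (h : T N α l i w 1 c) (j : Bool) : T N α l j w 1 c := by
  by_cases hj : i = j
  · subst hj; exact h
  · obtain rfl : i = !j := by cases i <;> cases j <;> simp_all
    exact (T.switch j w 1 c (by simpa using h)).cast H rfl (by simp) (by simp [H.l1])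

lemma T.rot1 {i : Bool} {x : (Bool × ℕ) × Bool} {w : List ((Bool × ℕ) × Bool)} {c : ℝ}
    (H : Hyp N α l) (h : T N α l i (x :: w) 1 c) : T N α l i (w ++ [x]) 1 c := by
  obtain ⟨⟨j, n⟩, b⟩ := x
  have h1 := ((h.side H j).extract H j n b w rfl).1 rfl
  exact ((T.mul _ _ _ _ _ _ _ h1 (T.letter j n b)).cast H rfl (by group) (by simp)).side H i

lemma T.rot {i : Bool} {p q : List ((Bool × ℕ) × Bool)} {c : ℝ}
    (H : Hyp N α l) (h : T N α l i (p ++ q) 1 c) : T N α l i (q ++ p) 1 c := by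
  induction p generalizing q with
  | nil => simpa using h
  | cons x p ih =>
    have h1 : T N α l i (p ++ q ++ [x]) 1 c := T.rot1 H h
    rw [List.append_assoc] at h1
    simpa using ih h1

lemma T.cancel {i : Bool} {x : Bool × ℕ} {b : Bool} {w : List ((Bool × ℕ) × Bool)} {c : ℝ}
    (H : Hyp N α l) : T N α l i ((x, b) :: (x, !b) :: w) 1 c ↔ T N α l i w 1 c := by
  obtain ⟨j, n⟩ := x
  have e : (FreeGroup.mk [(n, !b)] : F) = (FreeGroup.mk [(n, b)])⁻¹ := by
    simp [FreeGroup.invRev]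
  constructor
  · intro h
    have h1 := ((h.side H j).extract H j n b _ rfl).1 rfl
    have h2 := (h1.extract H j n (!b) _ rfl).1 rfl
    exact (h2.cast H rfl (by rw [e]; group) le_rfl).side H i
  · intro h
    exact ((T.mul _ _ _ _ _ _ _ (T.letter j n b) (T.mul _ _ _ _ _ _ _ (T.letter j n (!b))
      (h.side H j))).cast H rfl (by rw [e]; group) (by simp)).side H i

lemma T.step {i : Bool} {w w' : List ((Bool × ℕ) × Bool)} {c : ℝ}
    (H : Hyp N α l) (hs : FreeGroup.Red.Step w w') : T N α l i w 1 c ↔ T N α l i w' 1 c := by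
  obtain ⟨p, q, x, b⟩ := hs
  rename_i p q x b
  constructor
  · intro h
    exact T.rot H ((T.cancel H).1 (T.rot H h))
  · intro h
    exact T.rot H (p := (x, b) :: (x, !b) :: q) ((T.cancel H).2 (T.rot H h))

lemma T.inv {i : Bool} {w : List ((Bool × ℕ) × Bool)} {g : F} {c : ℝ} (H : Hyp N α l)
    (h : T N α l i w g c) : T N α l i (FreeGroup.invRev w) g⁻¹ c := by
  induction h with
  | nil i => exact (T.nil i).cast H rfl (by simp) le_rfl
  | letter i n s =>
    exact (T.letter i n (!s)).cast H rfl (by simp [FreeGroup.invRev]) le_rfl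
  | mul i w w' g g' c c' _ _ ih1 ih2 =>
    exact (T.mul _ _ _ _ _ _ _ ih2 ih1).cast H (by simp [FreeGroup.invRev]) (by simp)
      (by linarith)
  | slack i w g g' c c' _ h ih =>
    exact T.slack _ _ _ _ _ _ ih (by rw [(H.pn i).inv2]; exact h)
  | switch i w s c _ ih =>
    exact (T.switch i _ s⁻¹ c (ih.cast H rfl (by simp) le_rfl)).cast H rfl (by simp)
      (by rw [H.linv])

lemma T.word (N : Bool → F → ℝ) (α : Bool → A →* F) (l : A → ℝ) (H : Hyp N α l) (k : Bool)
    (L : List (ℕ × Bool)) :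
    T N α l k (L.map (fun p => ((k, p.1), p.2))) (FreeGroup.mk L) 0 := by
  induction L with
  | nil => exact T.nil k
  | cons p L ih =>
    exact (T.mul _ _ _ _ _ _ _ (T.letter k p.1 p.2) ih).cast H rfl (by simp) (by simp)

/-- The group element version. -/
def TG (N : Bool → F → ℝ) (α : Bool → A →* F) (l : A → ℝ) (x : GG) (c : ℝ) : Prop :=
  Quot.liftOn (r := FreeGroup.Red.Step) x (fun w => ∃ _ : Hyp N α l, T N α l true w 1 c)
    (fun _ _ h => propext ⟨fun ⟨H, t⟩ => ⟨H, (T.step H h).1 t⟩,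
      fun ⟨H, t⟩ => ⟨H, (T.step H h).2 t⟩⟩)

lemma TG_mk (H : Hyp N α l) (w : List ((Bool × ℕ) × Bool)) (c : ℝ) :
    TG N α l (FreeGroup.mk w) c ↔ T N α l true w 1 c :=
  ⟨fun ⟨_, t⟩ => t, fun t => ⟨H, t⟩⟩

/-- Embedding of the `k`-th copy. -/
def inc (k : Bool) : F →* GG := FreeGroup.map (fun n => (k, n))

lemma inc_mk (k : Bool) (L : List (ℕ × Bool)) :
    inc k (FreeGroup.mk L) = FreeGroup.mk (L.map (fun p => ((k, p.1), p.2))) := by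
  simp [inc]

theorem amalgam (H : Hyp N α l) : ∃ M : GG → ℝ, PN M ∧ (∀ k g, M (inc k g) = N k g) ∧
    ∀ k s, M ((inc k (α k s))⁻¹ * inc (!k) (α (!k) s)) ≤ l s := by
  obtain ⟨M, hM, up, lo⟩ := exists_PN (fun (x : GG) c => 0 ≤ c ∧ (1 ≤ c ∨ TG N α l x c))
    (fun x c h => h.1) (fun x => ⟨zero_le_one, Or.inl le_rfl⟩)
    ⟨le_rfl, Or.inr ((TG_mk H [] 0).2 (T.nil _))⟩
    (by
      rintro x c ⟨h0, h | h⟩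
      · exact ⟨h0, Or.inl h⟩
      · refine ⟨h0, Or.inr ?_⟩
        induction x using Quot.inductionOn with
        | h w =>
          have h1 := (TG_mk H w c).1 h
          exact (TG_mk H (FreeGroup.invRev w) c).2 ((h1.inv H).cast H rfl (by simp) le_rfl))
    (by
      rintro x c y d ⟨hc, h⟩ ⟨hd, h'⟩
      refine ⟨add_nonneg hc hd, ?_⟩
      rcases h with h | h
      · left; linarith
      rcases h' with h' | h'
      · left; linarith
      right
      induction x using Quot.inductionOn with
      | h w =>
        induction y using Quot.inductionOn with
        | h v =>
          exact (TG_mk H (w ++ v) _).2 ((T.mul _ _ _ _ _ _ _ ((TG_mk H w c).1 h)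
            ((TG_mk H v d).1 h')).cast H rfl (by simp) le_rfl))
    (by
      rintro x c y ⟨h0, h | h⟩
      · exact ⟨h0, Or.inl h⟩
      · refine ⟨h0, Or.inr ?_⟩
        have rot : ∀ a b : GG, TG N α l (a * b) c → TG N α l (b * a) c := by
          intro a b hab
          induction a using Quot.inductionOn with
          | h w =>
            induction b using Quot.inductionOn with
            | h v =>
              exact (TG_mk H (v ++ w) c).2 (T.rot H ((TG_mk H (w ++ v) c).1 hab))
        exact rot y⁻¹ (y * x) (by simpa using h))
  have wd : ∀ k g, ∃ w, FreeGroup.mk w = inc k g ∧ T N α l k w g 0 := by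
    intro k g
    induction g using Quot.inductionOn with
    | h L => exact ⟨_, (inc_mk k L).symm, T.word N α l H k L⟩
  refine ⟨M, hM, fun k g => le_antisymm ?_ ?_, fun k s => ?_⟩
  · obtain ⟨w, hw, t⟩ := wd k g
    refine up _ _ ⟨(H.pn k).nonneg g, Or.inr ?_⟩
    rw [← hw, TG_mk H]
    exact (T.slack _ _ _ 1 _ _ t (by rw [mul_one, (H.pn k).inv, zero_add])).side H true
  · refine lo _ _ ?_
    rintro c ⟨h0, h | h⟩
    · exact ((H.pn k).le_one g).trans h
    · induction g using Quot.inductionOn with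
      | h L =>
        have h1 : TG N α l (FreeGroup.mk (L.map (fun p => ((k, p.1), p.2)))) c := by
          rw [← inc_mk]; exact h
        have h2 := (((TG_mk H _ c).1 h1).side H k).sound H k L rfl
        have h3 := h2.1 rfl
        rw [mul_one, (H.pn k).inv] at h3
        exact h3
  · obtain ⟨w, hw, t⟩ := wd k (α k s)
    obtain ⟨w', hw', t'⟩ := wd (!k) (α (!k) s)
    refine up _ _ ⟨H.l0 s, Or.inr ?_⟩
    have e : (inc k (α k s))⁻¹ * inc (!k) (α (!k) s) = FreeGroup.mk (FreeGroup.invRev w ++ w') := by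
      rw [← hw, ← hw']; simp
    rw [e, TG_mk H]
    exact ((T.mul _ _ _ _ _ _ _ (t.inv H) (T.switch k w' s 0 t')).cast H rfl (by simp)
      (by simp)).side H true

end amalgam


/-- Basic neighbourhoods in products of metric spaces. -/
lemma pi_nhd {ι E : Type*} [PseudoMetricSpace E] (U : Set (ι → E)) (hU : IsOpen U) (f : ι → E)
    (hf : f ∈ U) : ∃ (B : Finset ι) (ε : ℝ), 0 < ε ∧
      ∀ g : ι → E, (∀ b ∈ B, dist (g b) (f b) < ε) → g ∈ U := by
  obtain ⟨I, u, hu, hsub⟩ := isOpen_pi_iff.1 hU f hf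
  have h1 : ∀ a ∈ I, ∃ ε : ℝ, 0 < ε ∧ Metric.ball (f a) ε ⊆ u a := fun a ha =>
    Metric.isOpen_iff.1 (hu a ha).1 _ (hu a ha).2
  have h2 : ∃ ε : ℝ, 0 < ε ∧ ∀ a ∈ I, Metric.ball (f a) ε ⊆ u a := by
    clear hsub hu
    induction I using Finset.cons_induction with
    | empty => exact ⟨1, one_pos, by simp⟩
    | cons a I ha ih =>
      obtain ⟨ε, hε, h⟩ := ih fun b hb => h1 b (Finset.mem_cons_of_mem hb)
      obtain ⟨δ, hδ, h'⟩ := h1 a (Finset.mem_cons_self _ _)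
      refine ⟨min ε δ, lt_min hε hδ, fun b hb => ?_⟩
      rcases Finset.mem_cons.1 hb with rfl | hb
      · exact (Metric.ball_subset_ball (min_le_right _ _)).trans h'
      · exact (Metric.ball_subset_ball (min_le_left _ _)).trans (h b hb)
  obtain ⟨ε, hε, h⟩ := h2
  exact ⟨I, ε, hε, fun g hg => hsub fun a ha => h a ha (hg a ha)⟩

/-- Completion of a group with a pseudonorm. -/
lemma completion {G : Type} [Group G] (M : G → ℝ) (hM : PN M) :
    ∃ (H : Type) (_ : Group H) (_ : MetricSpace H), BiInvariantDist H ∧ CompleteSpace H ∧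
      ∃ φ : G →* H, (∀ a b, dist (φ a) (φ b) = M (a⁻¹ * b)) ∧ DenseRange φ := by
  let _ : PseudoMetricSpace (Additive G) :=
    { dist := fun a b => M (a.toMul⁻¹ * b.toMul)
      dist_self := fun a => by simp [hM.one]
      dist_comm := fun a b => hM.symm _ _
      dist_triangle := fun a b c => hM.tri _ _ _ }
  have hd : ∀ a b : Additive G, dist a b = M (a.toMul⁻¹ * b.toMul) := fun _ _ => rfl
  have hadd : ∀ g x y : Additive G, dist (g + x) (g + y) = dist x y := fun g x y =>
    hM.left g.toMul x.toMul y.toMul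
  have hadd' : ∀ g x y : Additive G, dist (x + g) (y + g) = dist x y := fun g x y =>
    hM.right g.toMul x.toMul y.toMul
  have hneg : ∀ x y : Additive G, dist (-x) (-y) = dist x y := fun x y =>
    hM.inv2 x.toMul y.toMul
  have _ : IsUniformAddGroup (Additive G) := by
    refine ⟨Metric.uniformContinuous_iff.2 fun ε hε => ⟨ε / 2, half_pos hε, ?_⟩⟩
    rintro ⟨a, b⟩ ⟨c, d⟩ h
    have h1 : dist a c < ε / 2 := lt_of_le_of_lt (le_max_left _ _) h
    have h2 : dist b d < ε / 2 := lt_of_le_of_lt (le_max_right _ _) h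
    show dist (a - b) (c - d) < ε
    have h3 := dist_triangle (a - b) (c - b) (c - d)
    rw [sub_eq_add_neg, sub_eq_add_neg, sub_eq_add_neg, hadd, hadd', hneg] at h3
    rw [sub_eq_add_neg, sub_eq_add_neg]
    linarith
  let C := UniformSpace.Completion (Additive G)
  have cadd : ∀ g x y : C, dist (g + x) (g + y) = dist x y := by
    intro g x y
    refine UniformSpace.Completion.induction_on₃ g x y ?_ ?_
    · exact isClosed_eq (by fun_prop) (by fun_prop)
    · intro a b c
      rw [← UniformSpace.Completion.coe_add, ← UniformSpace.Completion.coe_add,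
        UniformSpace.Completion.dist_eq, UniformSpace.Completion.dist_eq, hadd]
  have cadd' : ∀ g x y : C, dist (x + g) (y + g) = dist x y := by
    intro g x y
    refine UniformSpace.Completion.induction_on₃ g x y ?_ ?_
    · exact isClosed_eq (by fun_prop) (by fun_prop)
    · intro a b c
      rw [← UniformSpace.Completion.coe_add, ← UniformSpace.Completion.coe_add,
        UniformSpace.Completion.dist_eq, UniformSpace.Completion.dist_eq, hadd']
  refine ⟨Multiplicative C, inferInstance, inferInstanceAs (MetricSpace C), ?_, ?_, ?_⟩
  · exact fun g x y => ⟨cadd g.toAdd x.toAdd y.toAdd, cadd' g.toAdd x.toAdd y.toAdd⟩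
  · exact inferInstanceAs (CompleteSpace C)
  · refine ⟨⟨⟨fun g => Multiplicative.ofAdd ((Additive.ofMul g : Additive G) : C), ?_⟩, ?_⟩, ?_, ?_⟩
    · exact congrArg Multiplicative.ofAdd UniformSpace.Completion.coe_zero
    · intro x y
      exact congrArg Multiplicative.ofAdd (UniformSpace.Completion.coe_add (Additive.ofMul x) (Additive.ofMul y))
    · intro a b
      exact UniformSpace.Completion.dist_eq (Additive.ofMul a) (Additive.ofMul b)
    · exact UniformSpace.Completion.denseRange_coe (α := Additive G)

/-- Homomorphisms that are close on letters are close on words. -/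
lemma close_words {X G : Type*} [Group G] {M : G → ℝ} (hM : PN M) (f g : FreeGroup X →* G)
    (δ : ℝ) (L : List (X × Bool))
    (h : ∀ p ∈ L, M ((f (FreeGroup.of p.1))⁻¹ * g (FreeGroup.of p.1)) ≤ δ) :
    M ((f (FreeGroup.mk L))⁻¹ * g (FreeGroup.mk L)) ≤ L.length * δ := by
  induction L with
  | nil =>
    have e : (FreeGroup.mk [] : FreeGroup X) = 1 := rfl
    simp [e, hM.one]
  | cons p L ih =>
    have e : (FreeGroup.mk (p :: L) : FreeGroup X) = FreeGroup.mk [p] * FreeGroup.mk L := by simp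
    have h1 := ih fun q hq => h q (List.mem_cons_of_mem _ hq)
    have h2 : M ((f (FreeGroup.mk [p]))⁻¹ * g (FreeGroup.mk [p])) ≤ δ := by
      have h3 := h p List.mem_cons_self
      obtain ⟨x, b⟩ := p
      cases b with
      | true => exact h3
      | false =>
        have e : (FreeGroup.mk [(x, false)] : FreeGroup X) = (FreeGroup.of x)⁻¹ := rfl
        rw [e, map_inv, map_inv, hM.inv2]
        exact h3
    rw [e, map_mul, map_mul]
    have h3 := hM.mul2 (f (FreeGroup.mk [p])) (f (FreeGroup.mk L)) (g (FreeGroup.mk [p]))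
      (g (FreeGroup.mk L))
    simp only [List.length_cons]
    push_cast
    linarith

/-- `w` only involves generators with index `< n`. -/
def Supp (n : ℕ) (w : GG) : Prop := ∀ p ∈ w.toWord, p.1.2 < n

lemma exists_supp (B : Finset GG) (n0 : ℕ) : ∃ n, n0 ≤ n ∧ ∀ w ∈ B, Supp n w := by
  have h : ∀ w : GG, ∃ n, Supp n w := fun w => by
    refine ⟨(w.toWord.map (fun p => p.1.2)).sum + 1, fun p hp => ?_⟩
    exact Nat.lt_succ_of_le (List.single_le_sum (by simp) _ (List.mem_map_of_mem hp))
  choose f hf using h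
  refine ⟨n0 + B.sum f, Nat.le_add_right _ _, fun w hw p hp => ?_⟩
  have h1 := Finset.single_le_sum (f := f) (fun _ _ => Nat.zero_le _) hw
  exact (hf w p hp).trans_le (h1.trans (Nat.le_add_left _ _))

lemma hom_eq {G : Type*} [Group G] (f g : GG →* G) (n : ℕ)
    (h : ∀ k i, i < n → f (FreeGroup.of (k, i)) = g (FreeGroup.of (k, i))) (w : GG)
    (hw : Supp n w) : f w = g w := by
  have key : ∀ L : List ((Bool × ℕ) × Bool), (∀ p ∈ L, p.1.2 < n) →
      f (FreeGroup.mk L) = g (FreeGroup.mk L) := by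
    intro L
    induction L with
    | nil => intro _; exact (map_one f).trans (map_one g).symm
    | cons p L ih =>
      intro hL
      have e : (FreeGroup.mk (p :: L) : GG) = FreeGroup.mk [p] * FreeGroup.mk L := by simp
      rw [e, map_mul, map_mul, ih fun q hq => hL q (List.mem_cons_of_mem _ hq)]
      congr 1
      have hp := hL p List.mem_cons_self
      obtain ⟨⟨k, i⟩, b⟩ := p
      cases b with
      | true => exact h k i hp
      | false =>
        have e : (FreeGroup.mk [((k, i), false)] : GG) = (FreeGroup.of (k, i))⁻¹ := rfl
        rw [e, map_inv, map_inv, h k i hp]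
  have := key w.toWord hw
  rwa [FreeGroup.mk_toWord] at this

/-- The extension property on side `k`. -/
def EP (k : Bool) (d : F → ℝ) : Prop :=
  ∀ M : GG → ℝ, PN M → (∀ g, M (inc k g) = d g) → ∀ (n : ℕ) (B : Finset GG) (ε : ℝ), 0 < ε →
    ∃ σ : GG →* F, (∀ i < n, σ (FreeGroup.of (k, i)) = FreeGroup.of i) ∧
      ∀ w ∈ B, |d (σ w) - M w| < ε

/-- Joint pseudonorms. -/
def Joint (d : Bool → F → ℝ) : Set (GG → ℝ) := {M | PN M ∧ ∀ k g, M (inc k g) = d k g}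

lemma joint_nonempty (d : Bool → F → ℝ) (hd : ∀ k, PN (d k)) : (Joint d).Nonempty := by
  have H : Hyp d (A := Unit) (fun _ => 1) (fun _ => 0) :=
    ⟨hd, rfl, fun _ => le_rfl, fun _ => rfl, fun _ _ => by simp, fun i s => by simp [(hd _).one]⟩
  obtain ⟨M, hM, h, _⟩ := amalgam H
  exact ⟨M, hM, h⟩

lemma joint_compact (d : Bool → F → ℝ) : IsCompact (Joint d) := by
  refine (isCompact_univ_pi (fun _ : GG => isCompact_Icc (a := (0 : ℝ)) (b := 1))).of_isClosed_subset
    ?_ (fun M hM x _ => ⟨hM.1.nonneg x, hM.1.le_one x⟩)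
  have : Joint d = {M : GG → ℝ | M 1 = 0} ∩ {M | ∀ g, M g⁻¹ = M g} ∩
      {M | ∀ g h, M (g * h) ≤ M g + M h} ∩ {M | ∀ g h, M (h * g * h⁻¹) = M g} ∩
      {M | ∀ g, 0 ≤ M g} ∩ {M | ∀ g, M g ≤ 1} ∩ {M | ∀ k g, M (inc k g) = d k g} := by
    ext M
    constructor
    · rintro ⟨⟨a, b, c, d, e, f⟩, g⟩
      exact ⟨⟨⟨⟨⟨⟨a, b⟩, c⟩, d⟩, e⟩, f⟩, g⟩
    · rintro ⟨⟨⟨⟨⟨⟨a, b⟩, c⟩, d⟩, e⟩, f⟩, g⟩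
      exact ⟨⟨a, b, c, d, e, f⟩, g⟩
  rw [this]
  simp only [Set.ofPred_forall]
  refine ((((((?_ : IsClosed _).inter ?_).inter ?_).inter ?_).inter ?_).inter ?_).inter ?_
  · exact isClosed_eq (continuous_apply _) continuous_const
  · exact isClosed_iInter fun g => isClosed_eq (continuous_apply _) (continuous_apply _)
  · exact isClosed_iInter fun g => isClosed_iInter fun h =>
      isClosed_le (continuous_apply _) (by fun_prop)
  · exact isClosed_iInter fun g => isClosed_iInter fun h =>
      isClosed_eq (continuous_apply _) (continuous_apply _)
  · exact isClosed_iInter fun g => isClosed_le continuous_const (continuous_apply _)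
  · exact isClosed_iInter fun g => isClosed_le (continuous_apply _) continuous_const
  · exact isClosed_iInter fun g => isClosed_iInter fun h =>
      isClosed_eq (continuous_apply _) continuous_const

lemma joint_dense (d : Bool → F → ℝ) (hd : ∀ k, PN (d k)) (k : Bool) (hE : EP k (d k))
    (M : GG → ℝ) (hM : M ∈ Joint d) (i : ℕ) (B : Finset GG) (ε : ℝ) (hε : 0 < ε) :
    ∃ M' ∈ Joint d, (∀ w ∈ B, |M' w - M w| < ε) ∧
      ∃ v : F, M' ((FreeGroup.of (!k, i))⁻¹ * inc k v) < ε := by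
  classical
  obtain ⟨n, hn, hB⟩ := exists_supp B (i + 1)
  set K : ℕ := B.sup (fun w => w.toWord.length) with hK
  set δ : ℝ := ε / (K + 2) with hδ
  have hK2 : (0 : ℝ) < K + 2 := by positivity
  have hδ0 : 0 < δ := div_pos hε hK2
  have hδε : (K + 2) * δ = ε := by rw [hδ]; field_simp
  obtain ⟨L, hL⟩ := exists_nat_ge (1 / δ)
  -- finitely many short words
  have hfin : {s : FreeGroup (Fin n) | s.norm ≤ L}.Finite := by
    refine Set.Finite.of_finite_image (f := FreeGroup.toWord)
      ((List.finite_length_le (Fin n × Bool) L).subset ?_) FreeGroup.toWord_injective.injOn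
    rintro _ ⟨s, hs, rfl⟩
    exact hs
  let a : FreeGroup (Fin n) →* F := FreeGroup.map Fin.val
  obtain ⟨σ, hσ, hσB⟩ := hE M hM.1 (hM.2 k) n
    (B ∪ hfin.toFinset.image (fun s => inc (!k) (a s))) δ hδ0
  let b : FreeGroup (Fin n) →* F := σ.comp ((inc (!k)).comp a)
  have hclose : ∀ s, |d k (b s) - d (!k) (a s)| ≤ δ * s.norm := by
    intro s
    by_cases h1 : s.norm = 0
    · rw [FreeGroup.norm_eq_zero] at h1
      subst h1
      simp [(hd _).one]
    by_cases h2 : s.norm ≤ L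
    · have h3 := hσB (inc (!k) (a s)) (Finset.mem_union_right _ (Finset.mem_image_of_mem _
        (hfin.mem_toFinset.2 h2)))
      rw [hM.2] at h3
      have h4 : (1 : ℝ) ≤ s.norm := by exact_mod_cast Nat.one_le_iff_ne_zero.2 h1
      have h5 : δ * 1 ≤ δ * s.norm := mul_le_mul_of_nonneg_left h4 hδ0.le
      refine h3.le.trans ?_
      linarith
    · have h3 : (1 : ℝ) / δ ≤ s.norm := hL.trans (by exact_mod_cast (not_le.1 h2).le)
      rw [div_le_iff₀ hδ0] at h3
      have := (hd k).nonneg (b s)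
      have := (hd k).le_one (b s)
      have := (hd (!k)).nonneg (a s)
      have := (hd (!k)).le_one (a s)
      rw [abs_le]; constructor <;> linarith
  have H : Hyp d (fun j => if j = k then b else a) (fun s => δ * s.norm) := by
    refine ⟨hd, by simp, fun s => by positivity, fun s => by simp, fun s t => ?_, fun j s => ?_⟩
    · rw [← mul_add]
      exact mul_le_mul_of_nonneg_left (by exact_mod_cast FreeGroup.norm_mul_le s t) hδ0.le
    · have h1 := abs_le.1 (hclose s)
      by_cases hj : j = k
      · subst hj
        simp only [if_true, Bool.not_eq_self, if_false]
        linarith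
      · obtain rfl : j = !k := by cases j <;> cases k <;> simp_all
        simp only [Bool.not_not, if_true, Bool.not_eq_self, if_false]
        linarith
  obtain ⟨M', hM', hinc, hcl⟩ := amalgam H
  have hgen : ∀ j < n, M' ((FreeGroup.of (!k, j))⁻¹ * inc k (σ (FreeGroup.of (!k, j)))) ≤ δ := by
    intro j hj
    have := hcl (!k) (FreeGroup.of ⟨j, hj⟩)
    simpa [a, b, inc] using this
  refine ⟨M', ⟨hM', hinc⟩, fun w hw => ?_, σ (FreeGroup.of (!k, i)), ?_⟩
  · have h1 : M' (w⁻¹ * inc k (σ w)) ≤ w.toWord.length * δ := by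
      have := close_words hM' (MonoidHom.id GG) ((inc k).comp σ) δ w.toWord (by
        rintro ⟨⟨j, m⟩, c⟩ hp
        have hm : m < n := hB w hw _ hp
        by_cases hj : j = k
        · subst hj
          simp [hσ m hm, inc, hM'.one, hδ0.le]
        · obtain rfl : j = !k := by cases j <;> cases k <;> simp_all
          exact hgen m hm)
      simpa [FreeGroup.mk_toWord] using this
    have h2 := hM'.abs_sub w (inc k (σ w))
    rw [hinc] at h2
    have h3 := hσB w (Finset.mem_union_left _ hw)
    have h4 : (w.toWord.length : ℝ) ≤ K := by
      exact_mod_cast Finset.le_sup (f := fun w : GG => w.toWord.length) hw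
    have h5 : (w.toWord.length : ℝ) * δ ≤ K * δ := mul_le_mul_of_nonneg_right h4 hδ0.le
    have h6 := abs_sub_le (M' w) (d k (σ w)) (M w)
    linarith
  · have := hgen i hn
    have h5 : 0 ≤ (K : ℝ) * δ := by positivity
    linarith

/-- There is a joint pseudonorm in which both copies are dense. -/
lemma joint_exists (d : Bool → F → ℝ) (hd : ∀ k, PN (d k)) (hE : ∀ k, EP k (d k)) :
    ∃ M ∈ Joint d, ∀ (k : Bool) (i m : ℕ),
      ∃ v : F, M ((FreeGroup.of (!k, i))⁻¹ * inc k v) < 1 / ((m : ℝ) + 1) := by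
  have _ : CompactSpace (Joint d) := isCompact_iff_compactSpace.1 (joint_compact d)
  have _ : Nonempty (Joint d) := (joint_nonempty d hd).to_subtype
  let O : Bool × ℕ × ℕ → Set (Joint d) := fun t =>
    {M | ∃ v : F, M.1 ((FreeGroup.of (!t.1, t.2.1))⁻¹ * inc t.1 v) < 1 / ((t.2.2 : ℝ) + 1)}
  have hO : ∀ t, IsOpen (O t) := by
    intro t
    simp only [O, Set.ofPred_exists]
    exact isOpen_iUnion fun v => isOpen_lt ((continuous_apply _).comp continuous_subtype_val)
      continuous_const
  have hD : ∀ t, Dense (O t) := by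
    rintro ⟨k, i, m⟩
    rw [dense_iff_inter_open]
    rintro U hU ⟨M, hMU⟩
    obtain ⟨V, hV, rfl⟩ := isOpen_induced_iff.1 hU
    obtain ⟨B, ε, hε, hB⟩ := pi_nhd V hV M.1 hMU
    obtain ⟨M', hM', h1, v, hv⟩ := joint_dense d hd k (hE k) M.1 M.2 i B
      (min ε (1 / ((m : ℝ) + 1))) (lt_min hε (by positivity))
    refine ⟨⟨M', hM'⟩, hB _ fun b hb => ?_, v, hv.trans_le (min_le_right _ _)⟩
    rw [Real.dist_eq]
    exact (h1 b hb).trans_le (min_le_left _ _)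
  obtain ⟨M, hM⟩ := (dense_iInter_of_isOpen hO hD).nonempty
  refine ⟨M.1, M.2, fun k i m => ?_⟩
  exact Set.mem_iInter.1 hM (k, i, m)

lemma final_step (d : Bool → F → ℝ) (hd : ∀ k, PN (d k)) (hE : ∀ k, EP k (d k)) :
    ∃ (H : Type) (_ : Group H) (_ : MetricSpace H), BiInvariantDist H ∧ CompleteSpace H ∧
      ∃ φ : Bool → F →* H, ∀ k, (∀ a b, dist (φ k a) (φ k b) = d k (a⁻¹ * b)) ∧
        DenseRange (φ k) := by
  obtain ⟨M, ⟨hM, hMd⟩, hv⟩ := joint_exists d hd hE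
  obtain ⟨H, iG, iM, hbi, hc, φ, hφ, hφd⟩ := completion M hM
  refine ⟨H, iG, iM, hbi, hc, fun k => φ.comp (inc k), fun k => ⟨fun a b => ?_, ?_⟩⟩
  · simp only [MonoidHom.comp_apply]
    rw [hφ, ← map_inv, ← map_mul, hMd]
  · have key : ∀ x : GG, ∀ ε : ℝ, 0 < ε → ∃ v : F, M (x⁻¹ * inc k v) < ε := by
      intro x
      induction x using FreeGroup.induction_on with
      | C1 => intro ε hε; exact ⟨1, by simpa [hM.one] using hε⟩
      | of x =>
        intro ε hε
        obtain ⟨j, i⟩ := x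
        by_cases hj : j = k
        · subst hj
          exact ⟨FreeGroup.of i, by simpa [inc, hM.one] using hε⟩
        · obtain rfl : j = !k := by cases j <;> cases k <;> simp_all
          obtain ⟨m, hm⟩ := exists_nat_one_div_lt hε
          obtain ⟨v, h⟩ := hv k i m
          exact ⟨v, h.trans hm⟩
      | inv_of x ih =>
        intro ε hε
        obtain ⟨v, h⟩ := ih ε hε
        exact ⟨v⁻¹, by rw [map_inv, hM.inv2]; exact h⟩
      | mul x y ihx ihy =>
        intro ε hε
        obtain ⟨v, h⟩ := ihx (ε / 2) (half_pos hε)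
        obtain ⟨u, h'⟩ := ihy (ε / 2) (half_pos hε)
        refine ⟨v * u, ?_⟩
        rw [map_mul]
        linarith [hM.mul2 x y (inc k v) (inc k u)]
    rw [Metric.denseRange_iff]
    intro x r hr
    obtain ⟨y, hy⟩ := Metric.denseRange_iff.1 hφd x (r / 2) (half_pos hr)
    obtain ⟨v, h⟩ := key y (r / 2) (half_pos hr)
    refine ⟨v, ?_⟩
    have h2 := dist_triangle x (φ y) (φ (inc k v))
    rw [hφ y] at h2
    simp only [MonoidHom.comp_apply]
    linarith


/-- The space of metrics. -/
abbrev D := {f : FreeGroup ℕ × FreeGroup ℕ → Set.Icc (0 : ℝ) 1 //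
        IsBiInvMetric fun a b => (f (a, b) : ℝ)}

/-- The norm of a bi-invariant metric. -/
def nrm (d : D) (g : F) : ℝ := d.1 (1, g)

lemma nrm_eq (d : D) (a b : F) : (d.1 (a, b) : ℝ) = nrm d (a⁻¹ * b) := by
  have := d.2.2.1 a⁻¹ a b
  simp only [inv_mul_cancel] at this
  exact this.symm

lemma nrm_PN (d : D) : PN (nrm d) := by
  obtain ⟨⟨h0, hs, ht⟩, hl, hr⟩ := d.2
  refine ⟨(h0 1 1).2 rfl, fun g => ?_, fun g h => ?_, fun g h => ?_, fun g => (d.1 (1, g)).2.1,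
    fun g => (d.1 (1, g)).2.2⟩
  · have h1 := nrm_eq d g 1
    have h2 := hs g 1
    simp only [mul_one] at h1
    rw [← h1]; exact h2
  · have h1 := ht 1 g (g * h)
    have h2 := nrm_eq d g (g * h)
    rw [inv_mul_cancel_left] at h2
    rw [← h2]; exact h1
  · have h1 := hr h⁻¹ h (h * g)
    have h2 := nrm_eq d h (h * g)
    rw [inv_mul_cancel_left] at h2
    rw [mul_inv_cancel] at h1
    rw [← h2]
    exact h1

lemma exists_D (N : F → ℝ) (hN : PN N) (h : ∀ g, N g = 0 → g = 1) :
    ∃ d : D, ∀ g, nrm d g = N g := by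
  refine ⟨⟨fun p => ⟨N (p.1⁻¹ * p.2), hN.nonneg _, hN.le_one _⟩, ⟨?_, ?_, ?_⟩, ?_, ?_⟩, ?_⟩
  · intro x y
    constructor
    · intro h1
      have := h _ h1
      exact (inv_mul_eq_one.1 this)
    · rintro rfl
      simp [hN.one]
  · exact fun x y => hN.symm x y
  · exact fun x y z => hN.tri x y z
  · exact fun g x y => hN.left g x y
  · exact fun g x y => hN.right g x y
  · intro g; simp [nrm]

/-- The open sets realizing finite data. -/
def O (t : Bool × ℕ × List (GG × ℚ) × ℕ) : Set D :=
  {d | ∃ σ : GG →* F, (∀ i < t.2.1, σ (FreeGroup.of (t.1, i)) = FreeGroup.of i) ∧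
    ∀ p ∈ t.2.2.1, |nrm d (σ p.1) - p.2| < 1 / ((t.2.2.2 : ℝ) + 1)}

lemma nrm_cont (g : F) : Continuous fun d : D => nrm d g :=
  continuous_subtype_val.comp ((continuous_apply ((1 : F), g)).comp continuous_subtype_val)

lemma O_open (t) : IsOpen (O t) := by
  have : O t = ⋃ σ : GG →* F, ⋃ _ : ∀ i < t.2.1, σ (FreeGroup.of (t.1, i)) = FreeGroup.of i,
      ⋂ p ∈ t.2.2.1.toFinset, {d : D | |nrm d (σ p.1) - p.2| < 1 / ((t.2.2.2 : ℝ) + 1)} := by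
    ext d
    simp [O]
  rw [this]
  refine isOpen_iUnion fun σ => isOpen_iUnion fun _ => isOpen_biInter_finset fun p _ => ?_
  exact isOpen_lt (((nrm_cont _).sub continuous_const).abs) continuous_const

lemma mix_PN (N : F → ℝ) (hN : PN N) (t : ℝ) (h0 : 0 < t) (h1 : t < 1) :
    ∃ d : D, ∀ g, |nrm d g - N g| ≤ t := by
  classical
  let κ : F → ℝ := fun g => if g = 1 then 0 else 1
  have hκ : PN κ := by
    refine ⟨by simp [κ], fun g => by simp [κ], fun g h => ?_, fun g h => ?_, fun g => ?_,
      fun g => ?_⟩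
    · simp only [κ]
      by_cases hg : g = 1 <;> by_cases hh : h = 1 <;> by_cases hgh : g * h = 1 <;> simp_all
    · have : h * g * h⁻¹ = 1 ↔ g = 1 := conj_eq_one_iff
      simp [κ, this]
    · simp only [κ]; split_ifs <;> norm_num
    · simp only [κ]; split_ifs <;> norm_num
  have h1' : 0 < 1 - t := by linarith
  obtain ⟨d, hd⟩ := exists_D (fun g => (1 - t) * N g + t * κ g)
    ⟨by simp [hN.one, hκ.one], fun g => by simp only [hN.inv, hκ.inv],
      fun g h => by nlinarith [hN.mul g h, hκ.mul g h],
      fun g h => by simp only [hN.conj, hκ.conj],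
      fun g => by have := hN.nonneg g; have := hκ.nonneg g; positivity,
      fun g => by nlinarith [hN.le_one g, hκ.le_one g]⟩
    (by
      intro g hg
      by_contra hne
      have h2 : κ g = 1 := by simp [κ, hne]
      have h3 := mul_nonneg h1'.le (hN.nonneg g)
      simp only [h2] at hg
      linarith)
  refine ⟨d, fun g => ?_⟩
  rw [hd, abs_le]
  constructor <;> nlinarith [hN.nonneg g, hN.le_one g, hκ.nonneg g, hκ.le_one g]

lemma mem_closure_O (d : D) (k : Bool) (n : ℕ) (l : List (GG × ℚ)) (m : ℕ) (M : GG → ℝ)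
    (hM : PN M) (hd : ∀ g, M (inc k g) = nrm d g)
    (hl : ∀ p ∈ l, |M p.1 - p.2| < 1 / ((m : ℝ) + 1)) : d ∈ closure (O (k, n, l, m)) := by
  classical
  rw [mem_closure_iff]
  intro U hU hdU
  obtain ⟨V, hV, rfl⟩ := isOpen_induced_iff.1 hU
  obtain ⟨C, ε, hε, hC⟩ := pi_nhd V hV d.1 hdU
  obtain ⟨m', hm', hsupp⟩ := exists_supp
    ((l.toFinset.image Prod.fst) ∪ C.image (fun p => inc k (p.1⁻¹ * p.2))) n
  let θ : F →* GG := FreeGroup.lift fun i =>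
    if i < m' then FreeGroup.of (k, i) else FreeGroup.of (!k, i - m')
  let σ : GG →* F := FreeGroup.lift fun x => if x.1 = k then FreeGroup.of x.2
    else FreeGroup.of (m' + x.2)
  have hθσ : ∀ w, Supp m' w → θ (σ w) = w := by
    intro w hw
    refine hom_eq (θ.comp σ) (MonoidHom.id GG) m' ?_ w hw
    intro j i hi
    by_cases hj : j = k
    · subst hj
      simp [θ, σ, hi]
    · obtain rfl : j = !k := by cases j <;> cases k <;> simp_all
      simp [θ, σ]
  have hσk : ∀ g : F, σ (inc k g) = g := by
    intro g
    have : σ.comp (inc k) = MonoidHom.id F := by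
      ext i
      simp [σ, inc]
    exact DFunLike.congr_fun this g
  have hex : ∃ t : ℝ, 0 < t ∧ t < 1 ∧ t < ε ∧
      ∀ p ∈ l.toFinset, t < 1 / ((m : ℝ) + 1) - |M p.1 - p.2| := by
    have h1 : ∀ᶠ t : ℝ in nhdsWithin 0 (Set.Ioi 0), 0 < t ∧ t < 1 ∧ t < ε ∧
      ∀ p ∈ l.toFinset, t < 1 / ((m : ℝ) + 1) - |M p.1 - p.2| := by
      have small : ∀ c : ℝ, 0 < c → ∀ᶠ t : ℝ in nhdsWithin 0 (Set.Ioi 0), t < c := fun c hc =>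
        nhdsWithin_le_nhds (Iio_mem_nhds hc)
      refine (eventually_mem_nhdsWithin).and ((small 1 one_pos).and ((small ε hε).and ?_))
      rw [Filter.eventually_all_finset]
      intro p hp
      exact small _ (by linarith [hl p (List.mem_toFinset.1 hp)])
    exact h1.exists
  obtain ⟨t, ht0, ht1, htε, htl⟩ := hex
  obtain ⟨d', hd'⟩ := mix_PN (fun g => M (θ g))
    ⟨by simp [hM.one], fun g => by simp only [map_inv, hM.inv],
      fun g h => by simpa only [map_mul] using hM.mul _ _,
      fun g h => by simp only [map_mul, map_inv, hM.conj], fun g => hM.nonneg _,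
      fun g => hM.le_one _⟩ t ht0 ht1
  refine ⟨d', hC _ ?_, σ, ?_, ?_⟩
  · rintro ⟨a, b⟩ hab
    rw [Subtype.dist_eq, Real.dist_eq, nrm_eq d', nrm_eq d, ← hd]
    have h1 : Supp m' (inc k (a⁻¹ * b)) := hsupp _ (Finset.mem_union_right _
      (Finset.mem_image_of_mem (fun p : F × F => inc k (p.1⁻¹ * p.2)) hab))
    have h2 := hθσ _ h1
    rw [hσk] at h2
    have h3 := hd' (a⁻¹ * b)
    rw [h2] at h3
    linarith
  · intro i _
    simp [σ]
  · intro p hp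
    have hp' : p ∈ l.toFinset := List.mem_toFinset.2 hp
    have h1 := hθσ p.1 (hsupp _ (Finset.mem_union_left _ (Finset.mem_image_of_mem _ hp')))
    have h2 := hd' (σ p.1)
    rw [h1] at h2
    have h3 := htl p hp'
    have h4 := abs_sub_le (nrm d' (σ p.1)) (M p.1) p.2
    simp only
    linarith

/-- The comeager set. -/
def S : Set D := ⋂ t, (O t ∪ (closure (O t))ᶜ)

lemma S_residual : S ∈ residual D := by
  have _ : Countable GG :=
    Function.Injective.countable (FreeGroup.toWord_injective (α := Bool × ℕ))
  refine countable_iInter_mem.2 fun t => ?_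
  refine residual_of_dense_open ((O_open t).union isClosed_closure.isOpen_compl) ?_
  intro x
  by_cases hx : x ∈ closure (O t)
  · exact closure_mono Set.subset_union_left hx
  · exact subset_closure (Or.inr hx)

lemma S_EP (d : D) (hd : d ∈ S) (k : Bool) : EP k (nrm d) := by
  intro M hM hMd n B ε hε
  obtain ⟨m, hm⟩ := exists_nat_one_div_lt (half_pos hε)
  have hm0 : (0 : ℝ) < 1 / ((m : ℝ) + 1) := by positivity
  have hq : ∀ w : GG, ∃ q : ℚ, |M w - q| < 1 / ((m : ℝ) + 1) := by
    intro w
    obtain ⟨q, hq1, hq2⟩ := exists_rat_btwn (show M w < M w + 1 / ((m : ℝ) + 1) by linarith)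
    exact ⟨q, by rw [abs_lt]; constructor <;> linarith⟩
  choose q hq using hq
  have hl : ∀ p ∈ B.toList.map (fun w => (w, q w)), |M p.1 - p.2| < 1 / ((m : ℝ) + 1) := by
    intro p hp
    obtain ⟨w, _, rfl⟩ := List.mem_map.1 hp
    exact hq w
  have hc := mem_closure_O d k n _ m M hM hMd hl
  rcases Set.mem_iInter.1 hd (k, n, B.toList.map (fun w => (w, q w)), m) with h | h
  · obtain ⟨σ, h1, h2⟩ := h
    refine ⟨σ, h1, fun w hw => ?_⟩
    have h3 := h2 (w, q w) (List.mem_map_of_mem (Finset.mem_toList.2 hw))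
    have h4 := hq w
    have h5 := abs_sub_le (nrm d (σ w)) (q w) (M w)
    rw [abs_sub_comm] at h4
    simp only at h3
    linarith
  · exact absurd hc h

end BiInvGen

/-- In the Polish space `D` of bi-invariant metrics bounded by `1` on `F_∞`
(a subspace of `[0,1]^{F_∞ × F_∞}`) there is a comeager set `S` such that any two metrics in `S`
have isometrically isomorphic completions: for `d₁, d₂ ∈ S` there are a group `H` with complete
bi-invariant metric and isometric group monomorphisms of `(F_∞,d₁)` and `(F_∞,d₂)` into `H`,
each with dense image. -/
theorem generic_biinv_metric :
    ∃ S : Set {f : FreeGroup ℕ × FreeGroup ℕ → Set.Icc (0 : ℝ) 1 //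
        IsBiInvMetric fun a b => (f (a, b) : ℝ)},
      S ∈ residual {f : FreeGroup ℕ × FreeGroup ℕ → Set.Icc (0 : ℝ) 1 //
        IsBiInvMetric fun a b => (f (a, b) : ℝ)} ∧
      ∀ d₁ ∈ S, ∀ d₂ ∈ S,
        ∃ (H : Type) (_ : Group H) (_ : MetricSpace H),
          BiInvariantDist H ∧ CompleteSpace H ∧
          ∃ φ₁ φ₂ : FreeGroup ℕ →* H,
            Function.Injective φ₁ ∧ Function.Injective φ₂ ∧
            (∀ a b : FreeGroup ℕ, dist (φ₁ a) (φ₁ b) = (d₁.1 (a, b) : ℝ)) ∧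
            (∀ a b : FreeGroup ℕ, dist (φ₂ a) (φ₂ b) = (d₂.1 (a, b) : ℝ)) ∧
            DenseRange φ₁ ∧ DenseRange φ₂ := by
  refine ⟨BiInvGen.S, BiInvGen.S_residual, fun d₁ h₁ d₂ h₂ => ?_⟩
  obtain ⟨H, iG, iM, hbi, hc, φ, hφ⟩ := BiInvGen.final_step
    (fun k => BiInvGen.nrm (if k then d₁ else d₂)) (fun k => BiInvGen.nrm_PN _)
    (fun k => BiInvGen.S_EP _ (by cases k <;> simpa) k)
  have e₁ : ∀ a b : FreeGroup ℕ, dist (φ true a) (φ true b) = (d₁.1 (a, b) : ℝ) := fun a b => by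
    rw [(hφ true).1, BiInvGen.nrm_eq]; rfl
  have e₂ : ∀ a b : FreeGroup ℕ, dist (φ false a) (φ false b) = (d₂.1 (a, b) : ℝ) := fun a b => by
    rw [(hφ false).1, BiInvGen.nrm_eq]; rfl
  refine ⟨H, iG, iM, hbi, hc, φ true, φ false, ?_, ?_, e₁, e₂, (hφ true).2, (hφ false).2⟩
  · intro a b hab
    exact (d₁.2.1.1 a b).1 (by show (d₁.1 (a, b) : ℝ) = 0; rw [← e₁, hab, dist_self])
  · intro a b hab
    exact (d₂.2.1.1 a b).1 (by show (d₂.1 (a, b) : ℝ) = 0; rw [← e₂, hab, dist_self])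
end

section
/- Let κ be an uncountable cardinal such that κ^{<κ} = κ. Then there exists a group 𝔾_κ with a complete bi-invariant metric having a dense subset of cardinality at most κ, such that every group equipped with a bi-invariant metric that has a dense subset of cardinality at most κ admits an isometric group monomorphism into 𝔾_κ. -/
/-- A conjugation invariant seminorm on a group. -/
structure CNorm {G : Type} [Group G] (l : G → ℝ) : Prop where
  one : l 1 = 0
  mul : ∀ g h, l (g * h) ≤ l g + l h
  inv : ∀ g, l g⁻¹ = l g
  conj : ∀ x g, l (x * g * x⁻¹) = l g

namespace CNorm

variable {G : Type} [Group G] {l : G → ℝ}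

theorem nonneg (h : CNorm l) (g : G) : 0 ≤ l g := by
  have h1 := h.mul g g⁻¹
  rw [mul_inv_cancel, h.one, h.inv] at h1
  linarith

theorem comm (h : CNorm l) (x y : G) : l (x * y) = l (y * x) := by
  have := h.conj x (y * x)
  rw [← this]
  congr 1
  group

theorem comap {H : Type} [Group H] (h : CNorm l) (f : H →* G) : CNorm (fun x => l (f x)) where
  one := by simp [h.one]
  mul a b := by simpa using h.mul (f a) (f b)
  inv a := by simpa using h.inv (f a)
  conj a b := by simpa using h.conj (f a) (f b)

end CNorm

/-- A metric space with an isometric action and displacement bounded by `l`. -/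
structure GSp (G : Type) [Group G] (l : G → ℝ) where
  X : Type
  met : MetricSpace X
  act : MulAction G X
  iso : ∀ (g : G) (x y : X), dist (g • x) (g • y) = dist x y
  disp : ∀ (g : G) (x : X), dist (g • x) x ≤ l g

attribute [instance] GSp.met GSp.act

/-- Passing from a pseudometric space with action to a metric one. -/
theorem exists_GSp {G : Type} [Group G] (l : G → ℝ) (Y : Type) [PseudoMetricSpace Y]
    [MulAction G Y] (iso : ∀ (g : G) (x y : Y), dist (g • x) (g • y) = dist x y)
    (disp : ∀ (g : G) (x : Y), dist (g • x) x ≤ l g) :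
    ∃ (R : GSp G l) (q : Y → R.X), (∀ x y, dist (q x) (q y) = dist x y) ∧
      ∀ (g : G) x, q (g • x) = g • q x := by
  have : ContinuousConstSMul G Y :=
    ⟨fun g => (Isometry.of_dist_eq (iso g)).continuous⟩
  refine ⟨⟨SeparationQuotient Y, inferInstance, inferInstance, ?_, ?_⟩, SeparationQuotient.mk,
    ?_, ?_⟩
  · intro g x y
    obtain ⟨x, rfl⟩ := SeparationQuotient.surjective_mk x
    obtain ⟨y, rfl⟩ := SeparationQuotient.surjective_mk y
    rw [← SeparationQuotient.mk_smul, ← SeparationQuotient.mk_smul, SeparationQuotient.dist_mk,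
      SeparationQuotient.dist_mk, iso]
  · intro g x
    obtain ⟨x, rfl⟩ := SeparationQuotient.surjective_mk x
    rw [← SeparationQuotient.mk_smul, SeparationQuotient.dist_mk]
    exact disp g x
  · intro x y
    exact SeparationQuotient.dist_mk x y
  · intro g x
    exact SeparationQuotient.mk_smul g x

section Step

variable {Z A B : Type} [Group Z] [Group A] [Group B] {lA : A → ℝ} {lB : B → ℝ}

/-- The elementary costs for the relative induction. -/
def stepCost (i : Z →* A) (j : Z →* B) (P : GSp A lA) (Q : GSp B lB) (f : P.X → Q.X)
    (p q : A × Q.X) : Z ⊕ P.X → ℝ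
  | Sum.inl z => lA (p.1⁻¹ * q.1 * (i z)⁻¹) + dist p.2 (j z • q.2)
  | Sum.inr y => dist p.2 (f (p.1⁻¹ • y)) + dist (f (q.1⁻¹ • y)) q.2

theorem stepCost_nonneg (hA : CNorm lA) (i : Z →* A) (j : Z →* B) (P : GSp A lA)
    (Q : GSp B lB) (f : P.X → Q.X) (p q : A × Q.X) (t : Z ⊕ P.X) :
    0 ≤ stepCost i j P Q f p q t := by
  rcases t with z | y
  · exact add_nonneg (hA.nonneg _) dist_nonneg
  · exact add_nonneg dist_nonneg dist_nonneg

/-- The relative induction step. -/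
theorem step (hA : CNorm lA) (i : Z →* A) (j : Z →* B)
    (hl : ∀ z, lA (i z) = lB (j z)) (P : GSp A lA) (Q : GSp B lB) (f : P.X → Q.X)
    (hf : ∀ x y, dist (f x) (f y) = dist x y) (hfe : ∀ z x, f (i z • x) = j z • f x) :
    ∃ (R : GSp A lA) (g : Q.X → R.X), (∀ x y, dist (g x) (g y) = dist x y) ∧
      (∀ z x, g (j z • x) = i z • g x) ∧ (∀ (a : A) x, g (f (a • x)) = a • g (f x)) := by
  set c := stepCost i j P Q f with hc
  have c0 : ∀ p q t, 0 ≤ c p q t := stepCost_nonneg hA i j P Q f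
  have cb : ∀ p q, BddBelow (Set.range (c p q)) := fun p q => ⟨0, by
    rintro _ ⟨t, rfl⟩; exact c0 p q t⟩
  have : Nonempty (Z ⊕ P.X) := ⟨Sum.inl 1⟩
  have dle : ∀ p q t, (⨅ t, c p q t) ≤ c p q t := fun p q t => ciInf_le (cb p q) t
  have dnn : ∀ p q, 0 ≤ ⨅ t, c p q t := fun p q => le_ciInf (c0 p q)
  have csymm : ∀ p q t, ∃ t', c q p t' ≤ c p q t := by
    rintro p q (z | y)
    · refine ⟨Sum.inl z⁻¹, le_of_eq ?_⟩
      simp only [hc, stepCost]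
      congr 1
      · rw [← hA.inv, hA.comm]; congr 1; simp [mul_assoc]
      · rw [dist_comm, ← Q.iso (j z), ← mul_smul]; simp
    · exact ⟨Sum.inr y, le_of_eq (by simp only [hc, stepCost]; rw [add_comm, dist_comm q.2, dist_comm p.2])⟩
  have czy : ∀ p q r z y, c p r (Sum.inr y) ≤ c p q (Sum.inl z) + c q r (Sum.inr y) := by
    intro p q r z y
    simp only [hc, stepCost]
    have h1 : dist p.2 (f (p.1⁻¹ • y)) ≤ dist p.2 (j z • q.2)
        + dist (j z • q.2) (j z • f (q.1⁻¹ • y)) + dist (j z • f (q.1⁻¹ • y)) (f (p.1⁻¹ • y)) :=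
      dist_triangle4 _ _ _ _
    rw [Q.iso, ← hfe, hf] at h1
    have h2 := P.disp (p.1⁻¹ * q.1 * (i z)⁻¹) (i z • q.1⁻¹ • y)
    rw [← mul_smul, ← mul_smul] at h2
    have h3 : p.1⁻¹ * q.1 * (i z)⁻¹ * i z * q.1⁻¹ = p.1⁻¹ := by group
    rw [h3, dist_comm] at h2
    linarith
  have ctri : ∀ p q r t t', ∃ t'', c p r t'' ≤ c p q t + c q r t' := by
    rintro p q r (z | y) (z' | y')
    · refine ⟨Sum.inl (z * z'), ?_⟩
      simp only [hc, stepCost]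
      have h1 : lA (p.1⁻¹ * r.1 * (i (z * z'))⁻¹) ≤
          lA (p.1⁻¹ * q.1 * (i z)⁻¹) + lA (q.1⁻¹ * r.1 * (i z')⁻¹) := by
        have := hA.mul (p.1⁻¹ * q.1 * (i z)⁻¹) (i z * (q.1⁻¹ * r.1 * (i z')⁻¹) * (i z)⁻¹)
        rw [hA.conj] at this
        convert this using 2
        simp [mul_assoc]
      have h2 : dist p.2 (j (z * z') • r.2) ≤ dist p.2 (j z • q.2) + dist q.2 (j z' • r.2) := by
        rw [← Q.iso (j z) q.2, map_mul, mul_smul]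
        exact dist_triangle _ _ _
      linarith
    · exact ⟨Sum.inr y', czy p q r z y'⟩
    · refine ⟨Sum.inr y, ?_⟩
      have h1 := czy r q p (z'⁻¹) y
      have h2 : c r q (Sum.inl z'⁻¹) = c q r (Sum.inl z') := by
        simp only [hc, stepCost]
        congr 1
        · rw [← hA.inv, hA.comm]; congr 1; simp [mul_assoc]
        · rw [dist_comm, ← Q.iso (j z'), ← mul_smul]; simp
      have h3 : ∀ p q, c p q (Sum.inr y) = c q p (Sum.inr y) := by
        intro p q
        simp only [hc, stepCost]; rw [add_comm, dist_comm q.2, dist_comm p.2]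
      rw [h3 p r, h3 p q]
      linarith
    · refine ⟨Sum.inr y, ?_⟩
      simp only [hc, stepCost]
      have h1 : dist (f (r.1⁻¹ • y)) r.2 ≤ dist (f (r.1⁻¹ • y)) (f (r.1⁻¹ • y'))
        + dist (f (r.1⁻¹ • y')) r.2 := dist_triangle _ _ _
      have h2 : dist (f (q.1⁻¹ • y)) (f (q.1⁻¹ • y')) ≤ dist (f (q.1⁻¹ • y)) q.2
        + dist q.2 (f (q.1⁻¹ • y')) := dist_triangle _ _ _
      rw [hf, P.iso] at h1 h2
      linarith
  have dsymm : ∀ p q, (⨅ t, c q p t) ≤ ⨅ t, c p q t := fun p q => le_ciInf fun t => by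
    obtain ⟨t', h⟩ := csymm p q t
    exact (dle q p t').trans h
  let _ : PseudoMetricSpace (A × Q.X) :=
    { dist := fun p q => ⨅ t, c p q t
      dist_self := fun p => le_antisymm ((dle p p (Sum.inl 1)).trans (by
        simp [hc, stepCost, hA.one])) (dnn p p)
      dist_comm := fun p q => le_antisymm (dsymm q p) (dsymm p q)
      dist_triangle := fun p q r => le_ciInf_add_ciInf fun t t' => by
        obtain ⟨t'', h⟩ := ctri p q r t t'
        exact (dle p r t'').trans h }
  have dd : ∀ p q : A × Q.X, dist p q = ⨅ t, c p q t := fun p q => rfl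
  let _ : MulAction A (A × Q.X) :=
    { smul := fun a p => (a * p.1, p.2)
      one_smul := fun p => Prod.ext (one_mul _) rfl
      mul_smul := fun a b p => Prod.ext (mul_assoc _ _ _) rfl }
  have sm : ∀ (a : A) (p : A × Q.X), a • p = (a * p.1, p.2) := fun a p => rfl
  have inv : ∀ (a : A) (p q : A × Q.X), dist (a • p) (a • q) ≤ dist p q := by
    intro a p q
    rw [dd p q]
    refine le_ciInf fun t => ?_
    rw [dd]
    rcases t with z | y
    · refine (dle _ _ (Sum.inl z)).trans (le_of_eq ?_)
      simp [hc, stepCost, sm, mul_assoc]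
    · refine (dle _ _ (Sum.inr (a • y))).trans (le_of_eq ?_)
      simp [hc, stepCost, sm, mul_smul]
  obtain ⟨R, π, hπ, hπe⟩ := exists_GSp lA (A × Q.X)
    (fun a p q => le_antisymm (inv a p q) (by
      have := inv a⁻¹ (a • p) (a • q)
      rwa [inv_smul_smul, inv_smul_smul] at this))
    (fun a p => by
      rw [dd]
      refine (dle _ _ (Sum.inl 1)).trans (le_of_eq ?_)
      simp only [hc, stepCost, sm, map_one, inv_one, mul_one, one_smul, dist_self, add_zero]
      rw [← hA.inv, ← hA.conj p.1⁻¹ a]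
      congr 1
      group)
  refine ⟨R, fun x => π (1, x), ?_, ?_, ?_⟩
  · intro x y
    rw [hπ, dd]
    refine le_antisymm ((dle _ _ (Sum.inl 1)).trans (by simp [hc, stepCost, hA.one])) ?_
    refine le_ciInf ?_
    rintro (z | w)
    · simp only [hc, stepCost]
      have h1 := dist_triangle x (j z • y) y
      have h2 := Q.disp (j z) y
      rw [← hl, ← hA.inv] at h2
      simp only [inv_one, mul_one, one_mul]
      linarith
    · simp only [hc, stepCost]
      have := dist_triangle x (f w) y
      simpa using this
  · intro z x
    rw [← hπe, ← dist_eq_zero, hπ, dd]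
    refine le_antisymm ((dle _ _ (Sum.inl z)).trans ?_) (dnn _ _)
    simp [hc, stepCost, sm, hA.one]
  · intro a x
    rw [← hπe, ← dist_eq_zero, hπ, dd]
    refine le_antisymm ((dle _ _ (Sum.inr (a • x))).trans ?_) (dnn _ _)
    simp [hc, stepCost, sm]

end Step

section Limit

theorem limit_action {X : ℕ → Type} [∀ n, MetricSpace (X n)] (s : ∀ n, X n → X (n + 1))
    (hs : ∀ n, Isometry (s n)) {G : Type} [Group G] (l : G → ℝ)
    (al : ∀ n, G → X n → X (n + 1)) (c1 : ∀ n x, al n 1 x = s n x)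
    (c2 : ∀ n a b x, al (n + 1) a (al n b x) = s (n + 1) (al n (a * b) x))
    (c3 : ∀ n a x y, dist (al n a x) (al n a y) = dist x y)
    (c4 : ∀ n a x, dist (al n a x) (s n x) ≤ l a) :
    ∃ act : MulAction G (Metric.InductiveLimit hs),
      (∀ (g : G) n x, act.toSMul.smul g (Metric.toInductiveLimit hs n x) =
        Metric.toInductiveLimit hs (n + 1) (al n g x)) ∧
      (∀ (g : G) x y, dist (act.toSMul.smul g x) (act.toSMul.smul g y) = dist x y) ∧
      (∀ (g : G) x, dist (act.toSMul.smul g x) x ≤ l g) := by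
  set ι := Metric.toInductiveLimit hs with hι
  have ιs : ∀ n x, ι (n + 1) (s n x) = ι n x := fun n x =>
    congrFun (Metric.toInductiveLimit_commute hs n) x
  have ιi : ∀ n, Isometry (ι n) := Metric.toInductiveLimit_isometry hs
  have surj : ∀ p : Metric.InductiveLimit hs, ∃ n x, ι n x = p := by
    rintro ⟨n, x⟩
    exact ⟨n, x, rfl⟩
  have raise : ∀ n x k, ∃ y : X (n + k), ι n x = ι (n + k) y ∧
      ∀ g, ι (n + 1) (al n g x) = ι (n + k + 1) (al (n + k) g y) := by
    intro n x k
    induction k with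
    | zero => exact ⟨x, rfl, fun g => rfl⟩
    | succ k ih =>
      obtain ⟨y, h1, h2⟩ := ih
      refine ⟨s _ y, ?_, ?_⟩
      · rw [h1]; exact (ιs (n + k) y).symm
      · intro g
        have h3 := c2 (n + k) g 1 y
        rw [mul_one, c1] at h3
        rw [h2, ← ιs (n + k + 1), ← h3]
        rfl
  have raise' : ∀ n x m, n ≤ m → ∃ y : X m, ι n x = ι m y ∧
      ∀ g, ι (n + 1) (al n g x) = ι (m + 1) (al m g y) := by
    intro n x m h
    obtain ⟨k, rfl⟩ := Nat.exists_eq_add_of_le h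
    exact raise n x k
  have wd : ∀ n x m y g, ι n x = ι m y → ι (n + 1) (al n g x) = ι (m + 1) (al m g y) := by
    intro n x m y g h
    obtain ⟨x', h1, h2⟩ := raise' n x (max n m) (le_max_left _ _)
    obtain ⟨y', h3, h4⟩ := raise' m y (max n m) (le_max_right _ _)
    rw [h2, h4]
    have : x' = y' := (ιi _).injective (by rw [← h1, ← h3, h])
    rw [this]
  have common : ∀ p q : Metric.InductiveLimit hs, ∃ n x y, ι n x = p ∧ ι n y = q := by
    intro p q
    obtain ⟨n, x, rfl⟩ := surj p
    obtain ⟨m, y, rfl⟩ := surj q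
    obtain ⟨x', h1, -⟩ := raise' n x (max n m) (le_max_left _ _)
    obtain ⟨y', h3, -⟩ := raise' m y (max n m) (le_max_right _ _)
    exact ⟨_, x', y', h1.symm, h3.symm⟩
  choose lev rep hrep using surj
  let sm : G → Metric.InductiveLimit hs → Metric.InductiveLimit hs :=
    fun g p => ι (lev p + 1) (al (lev p) g (rep p))
  have hsm : ∀ g n x, sm g (ι n x) = ι (n + 1) (al n g x) := by
    intro g n x
    exact wd _ _ _ _ g (hrep (ι n x))
  refine ⟨{ smul := sm, one_smul := ?_, mul_smul := ?_ }, hsm, ?_, ?_⟩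
  · intro a b p
    obtain ⟨n, x, y, rfl, -⟩ := common p p
    change sm (a * b) _ = sm a (sm b _)
    rw [hsm (a * b) n x, hsm b n x, hsm a (n + 1), c2, ιs]
  · intro p
    obtain ⟨n, x, y, rfl, -⟩ := common p p
    change sm 1 _ = _
    rw [hsm, c1, ιs]
  · intro g p q
    obtain ⟨n, x, y, rfl, rfl⟩ := common p q
    change dist (sm g _) (sm g _) = _
    rw [hsm, hsm, (ιi _).dist_eq, (ιi _).dist_eq, c3]
  · intro g p
    obtain ⟨n, x, y, rfl, -⟩ := common p p
    change dist (sm g _) _ ≤ _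
    rw [hsm, ← ιs n x, (ιi _).dist_eq]
    exact c4 n g x

end Limit

section Amalgam

variable {Z A B : Type} [Group Z] [Group A] [Group B] {lA : A → ℝ} {lB : B → ℝ}

/-- A pair of spaces in the tower. -/
structure Stage (lA : A → ℝ) (lB : B → ℝ) (i : Z →* A) (j : Z →* B) where
  P : GSp A lA
  Q : GSp B lB
  f : P.X → Q.X
  hf : ∀ x y, dist (f x) (f y) = dist x y
  hfe : ∀ z x, f (i z • x) = j z • f x

theorem Stage.next (hA : CNorm lA) (hB : CNorm lB) (i : Z →* A) (j : Z →* B)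
    (hl : ∀ z, lA (i z) = lB (j z)) (S : Stage lA lB i j) :
    ∃ (T : Stage lA lB i j) (g : S.Q.X → T.P.X), (∀ x y, dist (g x) (g y) = dist x y) ∧
      (∀ z x, g (j z • x) = i z • g x) ∧ (∀ (a : A) x, g (S.f (a • x)) = a • g (S.f x)) ∧
      (∀ (b : B) x, T.f (g (b • x)) = b • T.f (g x)) := by
  obtain ⟨R, g, hg, hge, hgf⟩ := step hA i j hl S.P S.Q S.f S.hf S.hfe
  obtain ⟨R', g', hg', hge', hgf'⟩ := step hB j i (fun z => (hl z).symm) S.Q R g hg hge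
  exact ⟨⟨R, R', g', hg', hge'⟩, g, hg, hge, hgf, hgf'⟩

theorem Stage.first (hA : CNorm lA) (hB : CNorm lB) (i : Z →* A) (j : Z →* B)
    (hl : ∀ z, lA (i z) = lB (j z)) :
    ∃ (T : Stage lA lB i j) (x : T.P.X), ∀ a : A, dist (a • x) x = lA a := by
  let _ : PseudoMetricSpace A :=
    { dist := fun x y => lA (x⁻¹ * y)
      dist_self := fun x => by simp [hA.one]
      dist_comm := fun x y => by rw [← hA.inv]; simp
      dist_triangle := fun x y z => by
        have := hA.mul (x⁻¹ * y) (y⁻¹ * z)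
        convert this using 2
        group }
  have dd : ∀ x y : A, dist x y = lA (x⁻¹ * y) := fun _ _ => rfl
  obtain ⟨P, q, hq, hqe⟩ := exists_GSp lA A (fun a x y => by simp [dd, mul_assoc])
    (fun a x => by
      rw [dd, ← hA.inv a, ← hA.conj x⁻¹ a⁻¹]
      refine le_of_eq ?_
      congr 1
      simp)
  let E : GSp B lB :=
    { X := PEmpty
      met := { dist := fun x _ => x.elim
               dist_self := fun x => x.elim
               dist_comm := fun x => x.elim
               dist_triangle := fun x => x.elim
               eq_of_dist_eq_zero := fun {x} => x.elim }
      act := { smul := fun _ x => x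
               one_smul := fun x => x.elim
               mul_smul := fun _ _ x => x.elim }
      iso := fun _ x => x.elim
      disp := fun _ x => x.elim }
  obtain ⟨R, g, hg, hge, -⟩ := step hB j i (fun z => (hl z).symm) E P
    (fun x => x.elim) (fun x => x.elim) (fun _ x => x.elim)
  refine ⟨⟨P, R, g, hg, hge⟩, q 1, fun a => ?_⟩
  rw [← hqe, hq, dd, ← hA.inv]
  simp

theorem amalgam_space (hA : CNorm lA) (hB : CNorm lB) (i : Z →* A) (j : Z →* B)
    (hl : ∀ z, lA (i z) = lB (j z)) :
    ∃ (PA : GSp A lA) (actB : MulAction B PA.X),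
      (∀ (b : B) (x y : PA.X), dist (actB.toSMul.smul b x) (actB.toSMul.smul b y) = dist x y) ∧
      (∀ (b : B) (x : PA.X), dist (actB.toSMul.smul b x) x ≤ lB b) ∧
      (∀ z (x : PA.X), i z • x = actB.toSMul.smul (j z) x) ∧
      ∃ x : PA.X, ∀ a : A, dist (a • x) x = lA a := by
  obtain ⟨S0, x0, hx0⟩ := Stage.first hA hB i j hl
  choose nx g hg hge hgA hgB using Stage.next hA hB i j hl
  let S : ℕ → Stage lA lB i j := fun n => Nat.rec S0 (fun _ T => nx T) n
  have hS : ∀ n, S (n + 1) = nx (S n) := fun n => rfl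
  let X : ℕ → Type := fun n => (S n).P.X
  let G : ∀ n, (S n).Q.X → (S (n + 1)).P.X := fun n => g (S n)
  let s : ∀ n, X n → X (n + 1) := fun n x => G n ((S n).f x)
  have hG : ∀ n x y, dist (G n x) (G n y) = dist x y := fun n => hg (S n)
  have hs : ∀ n, Isometry (s n) := fun n => Isometry.of_dist_eq fun x y => by
    simp only [s]
    rw [hG, (S n).hf]
  have hsA : ∀ n (a : A) x, s n (a • x) = a • s n x := fun n => hgA (S n)
  have hsB : ∀ n (b : B) x, (S (n + 1)).f (G n (b • x)) = b • (S (n + 1)).f (G n x) :=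
    fun n => hgB (S n)
  have hGe : ∀ n z x, G n (j z • x) = i z • G n x := fun n => hge (S n)
  obtain ⟨aA, hA1, hA2, hA3⟩ := limit_action s hs lA (fun n a x => s n (a • x))
    (fun n x => by simp)
    (fun n a b x => by simp only [hsA, mul_smul])
    (fun n a x y => by rw [(hs n).dist_eq, (S n).P.iso])
    (fun n a x => by rw [(hs n).dist_eq]; exact (S n).P.disp a x)
  obtain ⟨aB, hB1, hB2, hB3⟩ := limit_action s hs lB (fun n b x => G n (b • (S n).f x))
    (fun n x => by simp [s])
    (fun n a b x => by simp only [s, hsB, mul_smul])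
    (fun n a x y => by rw [hG, (S n).Q.iso, (S n).hf])
    (fun n a x => by simp only [s]; rw [hG]; exact (S n).Q.disp a _)
  refine ⟨⟨Metric.InductiveLimit hs, inferInstance, aA, hA2, hA3⟩, aB, hB2, hB3, ?_,
    Metric.toInductiveLimit hs 0 x0, ?_⟩
  · rintro z ⟨n, x⟩
    change aA.toSMul.smul (i z) (Metric.toInductiveLimit hs n x) =
      aB.toSMul.smul (j z) (Metric.toInductiveLimit hs n x)
    rw [hA1, hB1]
    simp only [s]
    rw [(S n).hfe]
  · intro a
    change dist (aA.toSMul.smul a (Metric.toInductiveLimit hs 0 x0)) _ = _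
    rw [hA1, ← congrFun (Metric.toInductiveLimit_commute hs 0) x0, Function.comp_apply,
      (Metric.toInductiveLimit_isometry hs _).dist_eq, (hs 0).dist_eq]
    exact hx0 a

/-- Isometric bijections of bounded displacement. -/
def bddIso (X : Type) [MetricSpace X] : Subgroup (Equiv.Perm X) where
  carrier := {σ | (∀ x y, dist (σ x) (σ y) = dist x y) ∧ ∃ C : ℝ, ∀ x, dist (σ x) x ≤ C}
  one_mem' := ⟨fun x y => rfl, 0, fun x => by simp⟩
  mul_mem' := by
    rintro σ τ ⟨h1, C, h2⟩ ⟨h3, D, h4⟩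
    refine ⟨fun x y => by simp [h1, h3], C + D, fun x => ?_⟩
    have := dist_triangle (σ (τ x)) (τ x) x
    have h5 := h2 (τ x)
    have h6 := h4 x
    simp only [Equiv.Perm.coe_mul, Function.comp_apply]
    linarith
  inv_mem' := by
    rintro σ ⟨h1, C, h2⟩
    refine ⟨fun x y => by rw [← h1]; simp, C, fun x => ?_⟩
    rw [← h1, dist_comm]
    simpa using h2 x

theorem bddIso_norm (X : Type) [MetricSpace X] [Nonempty X] :
    CNorm (fun σ : bddIso X => ⨆ x, dist (σ.1 x) x) := by
  have bd : ∀ σ : bddIso X, BddAbove (Set.range fun x => dist (σ.1 x) x) := by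
    rintro ⟨σ, h1, C, h2⟩
    exact ⟨C, by rintro _ ⟨x, rfl⟩; exact h2 x⟩
  have inv : ∀ σ : bddIso X, (⨆ x, dist ((σ⁻¹).1 x) x) ≤ ⨆ x, dist (σ.1 x) x := by
    intro σ
    refine ciSup_le fun x => ?_
    rw [← σ.2.1, dist_comm]
    simpa using le_ciSup (bd σ) x
  have conj : ∀ τ σ : bddIso X, (⨆ x, dist ((τ * σ * τ⁻¹).1 x) x) ≤ ⨆ x, dist (σ.1 x) x := by
    intro τ σ
    refine ciSup_le fun x => ?_
    rw [← (τ⁻¹).2.1]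
    simpa using le_ciSup (bd σ) (τ.1⁻¹ x)
  refine ⟨by simp, ?_, ?_, ?_⟩
  · intro σ τ
    refine ciSup_le fun x => ?_
    have := dist_triangle (σ.1 (τ.1 x)) (τ.1 x) x
    have h5 := le_ciSup (bd σ) (τ.1 x)
    have h6 := le_ciSup (bd τ) x
    simp only [Subgroup.coe_mul, Equiv.Perm.coe_mul, Function.comp_apply] at *
    linarith
  · intro σ
    exact le_antisymm (inv σ) (by simpa using inv σ⁻¹)
  · intro τ σ
    refine le_antisymm (conj τ σ) ?_
    have := conj τ⁻¹ (τ * σ * τ⁻¹)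
    have h : τ⁻¹ * (τ * σ * τ⁻¹) * τ⁻¹⁻¹ = σ := by group
    rwa [h] at this

theorem amalgam (hA : CNorm lA) (hB : CNorm lB) (i : Z →* A) (j : Z →* B)
    (hl : ∀ z, lA (i z) = lB (j z)) :
    ∃ (Γ : Type) (_ : Group Γ) (N : Γ → ℝ) (u : A →* Γ) (v : B →* Γ), CNorm N ∧
      (∀ z, u (i z) = v (j z)) ∧ (∀ a, N (u a) = lA a) ∧ (∀ b, N (v b) ≤ lB b) := by
  obtain ⟨P, aB, h1, h2, h3, x0, h4⟩ := amalgam_space hA hB i j hl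
  have : Nonempty P.X := ⟨x0⟩
  let u : A →* bddIso P.X := (MulAction.toPermHom A P.X).codRestrict (bddIso P.X)
    (fun a => ⟨P.iso a, lA a, P.disp a⟩)
  let v : B →* bddIso P.X := (@MulAction.toPermHom B P.X _ aB).codRestrict (bddIso P.X)
    (fun a => ⟨h1 a, lB a, h2 a⟩)
  refine ⟨bddIso P.X, inferInstance, _, u, v, bddIso_norm P.X, ?_, ?_, ?_⟩
  · intro z
    ext x
    exact h3 z x
  · intro a
    refine le_antisymm (ciSup_le (P.disp a)) ?_
    rw [← h4 a]
    exact le_ciSup (f := fun x => dist (a • x) x)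
      ⟨lA a, by rintro _ ⟨x, rfl⟩; exact P.disp a x⟩ x0
  · intro b
    exact ciSup_le (h2 b)

end Amalgam

section Cost

/-- `g` is a product of conjugates of priced letters with total price `r`. -/
inductive Cost {G : Type} [Group G] (T : Set (G × ℝ)) : G → ℝ → Prop
  | one : Cost T 1 0
  | mul (g : G) (r : ℝ) (x a : G) (s : ℝ) : Cost T g r → (a, s) ∈ T →
      Cost T (g * (x * a * x⁻¹)) (r + s)

variable {G : Type} [Group G] {T : Set (G × ℝ)}

theorem Cost.of_eq {g h : G} {r s : ℝ} (hc : Cost T g r) (h1 : g = h) (h2 : r = s) :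
    Cost T h s := by
  subst h1; subst h2; exact hc

theorem Cost.single {a : G} {s : ℝ} (h : (a, s) ∈ T) : Cost T a s :=
  (Cost.mul 1 0 1 a s Cost.one h).of_eq (by simp) (by simp)

theorem Cost.mul_mul {g h : G} {r s : ℝ} (h1 : Cost T g r) (h2 : Cost T h s) :
    Cost T (g * h) (r + s) := by
  induction h2 with
  | one => simpa using h1
  | mul h s x a t _ ha ih =>
    exact (Cost.mul _ _ x a t ih ha).of_eq (by group) (by ring)

theorem Cost.conj {g : G} {r : ℝ} (y : G) (h1 : Cost T g r) : Cost T (y * g * y⁻¹) r := by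
  induction h1 with
  | one => simpa using Cost.one
  | mul h s x a t _ ha ih =>
    exact (Cost.mul _ _ (y * x) a t ih ha).of_eq (by group) rfl

theorem Cost.inv (hT : ∀ a s, (a, s) ∈ T → (a⁻¹, s) ∈ T) {g : G} {r : ℝ} (h1 : Cost T g r) :
    Cost T g⁻¹ r := by
  induction h1 with
  | one => simpa using Cost.one
  | mul h s x a t _ ha ih =>
    exact (((Cost.single (hT _ _ ha)).conj x).mul_mul ih).of_eq (by group) (by ring)

theorem Cost.le_of_admissible {N : G → ℝ} (hN : CNorm N) (hT : ∀ a s, (a, s) ∈ T → N a ≤ s)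
    {g : G} {r : ℝ} (h1 : Cost T g r) : N g ≤ r := by
  induction h1 with
  | one => simp [hN.one]
  | mul h s x a t _ ha ih =>
    have := hN.mul h (x * a * x⁻¹)
    rw [hN.conj] at this
    have := hT _ _ ha
    linarith

/-- The seminorm generated by the priced letters. -/
noncomputable def cinf (T : Set (G × ℝ)) (g : G) : ℝ := sInf {r | Cost T g r}

theorem Cost.nonneg (h0 : ∀ a s, (a, s) ∈ T → 0 ≤ s) {g : G} {r : ℝ} (h1 : Cost T g r) : 0 ≤ r := by
  induction h1 with
  | one => exact le_rfl
  | mul h s x a t _ ha ih => exact add_nonneg ih (h0 _ _ ha)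

theorem cinf_le (h0 : ∀ a s, (a, s) ∈ T → 0 ≤ s) {g : G} {r : ℝ} (h1 : Cost T g r) : cinf T g ≤ r :=
  csInf_le ⟨0, fun _ h => Cost.nonneg h0 h⟩ h1

theorem le_cinf (ht : ∀ g, ∃ r, Cost T g r) {g : G} {b : ℝ} (h : ∀ r, Cost T g r → b ≤ r) :
    b ≤ cinf T g :=
  le_csInf (ht g) h

theorem cinf_norm (h0 : ∀ a s, (a, s) ∈ T → 0 ≤ s) (hT : ∀ a s, (a, s) ∈ T → (a⁻¹, s) ∈ T)
    (ht : ∀ g, ∃ r, Cost T g r) : CNorm (cinf T) := by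
  have inv : ∀ g, cinf T g⁻¹ ≤ cinf T g := fun g =>
    le_cinf ht fun r hr => cinf_le h0 (hr.inv hT)
  have conj : ∀ x g, cinf T (x * g * x⁻¹) ≤ cinf T g := fun x g =>
    le_cinf ht fun r hr => cinf_le h0 (hr.conj x)
  refine ⟨?_, ?_, ?_, ?_⟩
  · exact le_antisymm (cinf_le h0 Cost.one) (le_cinf ht fun r hr => hr.nonneg h0)
  · intro g h
    have : cinf T (g * h) - cinf T h ≤ cinf T g := le_cinf ht fun r hr => by
      have : cinf T (g * h) - r ≤ cinf T h := le_cinf ht fun s hs => by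
        have := cinf_le h0 (hr.mul_mul hs)
        linarith
      linarith
    linarith
  · intro g
    exact le_antisymm (inv g) (by simpa using inv g⁻¹)
  · intro x g
    refine le_antisymm (conj x g) ?_
    have h := conj x⁻¹ (x * g * x⁻¹)
    have e : x⁻¹ * (x * g * x⁻¹) * x⁻¹⁻¹ = g := by group
    rwa [e] at h

end Cost

section Universal

open Set

/-- One-point extension problems. -/
abbrev Prob (I : Type) [LinearOrder I] : Type :=
  Σ β : I, (Iio β → I) × (FreeGroup (Iic β) → ℝ)

variable {I : Type} [LinearOrder I]

/-- The embedding of the variables of problem `p α`, the new variable being `α`. -/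
noncomputable def embV (p : I → Prob I) (α : I) (γ : Iic (p α).1) : I :=
  open Classical in if h : γ.1 < (p α).1 then (p α).2.1 ⟨γ.1, h⟩ else α

/-- The homomorphism induced by `embV`. -/
noncomputable def emb (p : I → Prob I) (α : I) : FreeGroup (Iic (p α).1) →* FreeGroup I :=
  FreeGroup.map (embV p α)

/-- The priced letters attached to a set of indices. -/
def letters (p : I → Prob I) (J : Set I) : Set (FreeGroup I × ℝ) :=
  {x | (∃ α ∈ J, ∃ w, x = (emb p α w, (p α).2.2 w)) ∨
    ∃ γ, γ ∉ J ∧ (x = (FreeGroup.of γ, 0) ∨ x = ((FreeGroup.of γ)⁻¹, 0))}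

/-- The seminorm attached to a set of indices. -/
noncomputable def NJ (p : I → Prob I) (J : Set I) : FreeGroup I → ℝ := cinf (letters p J)

/-- Basic validity. -/
def GoodIdx (p : I → Prob I) (α : I) : Prop :=
  CNorm (p α).2.2 ∧ ∀ γ, (p α).2.1 γ < α

/-- inclusion of strict into weak initial segments -/
def incl (β : I) : FreeGroup (Iio β) →* FreeGroup (Iic β) :=
  FreeGroup.map (fun γ => ⟨γ.1, le_of_lt γ.2⟩)

theorem letters_nonneg (p : I → Prob I) (J : Set I) (hJ : ∀ α ∈ J, GoodIdx p α) :
    ∀ a s, (a, s) ∈ letters p J → 0 ≤ s := by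
  rintro a s (⟨α, hα, w, h⟩ | ⟨γ, hγ, h | h⟩)
  · rw [(Prod.mk.inj h).2]; exact (hJ α hα).1.nonneg _
  · rw [(Prod.mk.inj h).2]
  · rw [(Prod.mk.inj h).2]

theorem letters_inv (p : I → Prob I) (J : Set I) (hJ : ∀ α ∈ J, GoodIdx p α) :
    ∀ a s, (a, s) ∈ letters p J → (a⁻¹, s) ∈ letters p J := by
  rintro a s (⟨α, hα, w, h⟩ | ⟨γ, hγ, h | h⟩)
  · obtain ⟨rfl, rfl⟩ := Prod.mk.inj h
    exact Or.inl ⟨α, hα, w⁻¹, by rw [map_inv, (hJ α hα).1.inv]⟩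
  · obtain ⟨rfl, rfl⟩ := Prod.mk.inj h
    exact Or.inr ⟨γ, hγ, Or.inr rfl⟩
  · obtain ⟨rfl, rfl⟩ := Prod.mk.inj h
    exact Or.inr ⟨γ, hγ, Or.inl (by simp)⟩

theorem emb_top (p : I → Prob I) (α : I) :
    emb p α (FreeGroup.of ⟨(p α).1, le_rfl⟩) = FreeGroup.of α := by
  simp [emb, embV]

theorem letters_total (p : I → Prob I) (J : Set I) (hJ : ∀ α ∈ J, GoodIdx p α) :
    ∀ g, ∃ r, Cost (letters p J) g r := by
  have key : ∀ γ : I, ∃ r, Cost (letters p J) (FreeGroup.of γ) r := by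
    intro γ
    by_cases h : γ ∈ J
    · exact ⟨_, Cost.single (Or.inl ⟨γ, h, _, by rw [emb_top]⟩)⟩
    · exact ⟨_, Cost.single (Or.inr ⟨γ, h, Or.inl rfl⟩)⟩
  intro g
  induction g using FreeGroup.induction_on with
  | C1 => exact ⟨0, Cost.one⟩
  | of γ => exact key γ
  | inv_of γ h => obtain ⟨r, hr⟩ := h; exact ⟨r, hr.inv (letters_inv p J hJ)⟩
  | mul x y hx hy =>
    obtain ⟨r, hr⟩ := hx
    obtain ⟨s, hs⟩ := hy
    exact ⟨_, hr.mul_mul hs⟩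

theorem NJ_norm (p : I → Prob I) (J : Set I) (hJ : ∀ α ∈ J, GoodIdx p α) : CNorm (NJ p J) :=
  cinf_norm (letters_nonneg p J hJ) (letters_inv p J hJ) (letters_total p J hJ)

/-- Killing the generators outside `D`. -/
noncomputable def rho (D : Set I) : FreeGroup I →* FreeGroup I :=
  open Classical in FreeGroup.lift (fun γ => if γ ∈ D then FreeGroup.of γ else 1)

theorem rho_of_mem {D : Set I} {γ : I} (h : γ ∈ D) : rho D (FreeGroup.of γ) = FreeGroup.of γ := by
  simp [rho, h]

theorem rho_of_notMem {D : Set I} {γ : I} (h : γ ∉ D) : rho D (FreeGroup.of γ) = 1 := by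
  simp [rho, h]

theorem rho_mono {D E : Set I} (h : D ⊆ E) {g : FreeGroup I} (hg : rho D g = g) :
    rho E g = g := by
  have : (rho E).comp (rho D) = rho D := by
    ext γ
    by_cases hγ : γ ∈ D
    · simp [rho_of_mem hγ, rho_of_mem (h hγ)]
    · simp [rho_of_notMem hγ]
  have h2 := DFunLike.congr_fun this g
  simpa [hg] using h2

theorem rho_map {K : Type} {D : Set I} (e : K → I) (he : ∀ k, e k ∈ D) (w : FreeGroup K) :
    rho D (FreeGroup.map e w) = FreeGroup.map e w := by
  have : (rho D).comp (FreeGroup.map e) = FreeGroup.map e := by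
    ext k
    simp [rho_of_mem (he k)]
  exact DFunLike.congr_fun this w

theorem embV_le (p : I → Prob I) {α : I} (h : GoodIdx p α) (γ) : embV p α γ ≤ α := by
  unfold embV
  split_ifs with h1
  · exact (h.2 _).le
  · exact le_rfl

theorem rho_emb (p : I → Prob I) {α : I} (h : GoodIdx p α) {D : Set I} (hD : Iic α ⊆ D) (w) :
    rho D (emb p α w) = emb p α w :=
  rho_map _ (fun γ => hD (embV_le p h γ)) w

/-- Every element is supported below some element of `D`. -/
theorem rho_fin (D : Set I) (w : FreeGroup I) :
    rho D w = 1 ∨ ∃ γ ∈ D, rho (Iic γ) (rho D w) = rho D w := by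
  induction w using FreeGroup.induction_on with
  | C1 => left; simp
  | of γ =>
    by_cases h : γ ∈ D
    · right
      refine ⟨γ, h, ?_⟩
      rw [rho_of_mem h, rho_of_mem (mem_Iic.2 le_rfl)]
    · left; exact rho_of_notMem h
  | inv_of γ h =>
    rcases h with h | ⟨γ, h1, h2⟩
    · left; rw [map_inv, h, inv_one]
    · right; exact ⟨γ, h1, by rw [map_inv, map_inv, h2]⟩
  | mul x y hx hy =>
    rcases hx with hx | ⟨γ, h1, h2⟩
    · rw [map_mul, hx, one_mul]; exact hy
    · right
      rcases hy with hy | ⟨δ, h3, h4⟩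
      · rw [map_mul, hy, mul_one]; exact ⟨γ, h1, h2⟩
      · rcases le_total γ δ with h | h
        · exact ⟨δ, h3, by rw [map_mul, map_mul, h4, rho_mono (Iic_subset_Iic.2 h) h2]⟩
        · exact ⟨γ, h1, by rw [map_mul, map_mul, h2, rho_mono (Iic_subset_Iic.2 h) h4]⟩

variable [WellFoundedLT I]

/-- The valid indices. -/
def valid (p : I → Prob I) : I → Prop :=
  (wellFounded_lt (α := I)).fix (fun α ih => GoodIdx p α ∧
    ∀ w, NJ p {β | ∃ h : β < α, ih β h} (FreeGroup.map (p α).2.1 w) =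
      (p α).2.2 (incl _ w))

/-- valid indices in `D` -/
def VS (p : I → Prob I) (D : Set I) : Set I := {β | β ∈ D ∧ valid p β}

theorem valid_iff (p : I → Prob I) (α : I) : valid p α ↔ GoodIdx p α ∧
    ∀ w, NJ p (VS p (Iio α)) (FreeGroup.map (p α).2.1 w) = (p α).2.2 (incl _ w) := by
  rw [valid, WellFounded.fix_eq]
  have : {β | ∃ _ : β < α, (wellFounded_lt (α := I)).fix (fun α ih => GoodIdx p α ∧
    ∀ w, NJ p {β | ∃ h : β < α, ih β h} (FreeGroup.map (p α).2.1 w) =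
      (p α).2.2 (incl _ w)) β} = VS p (Iio α) := by
    ext β
    simp only [mem_setOf_eq, VS, mem_Iio, exists_prop]
    rfl
  rw [this]

theorem VS_good (p : I → Prob I) (D : Set I) : ∀ α ∈ VS p D, GoodIdx p α :=
  fun α h => ((valid_iff p α).1 h.2).1

/-- The result of the one-point amalgamation. -/
theorem one_step_aux (p : I → Prob I) {α : I} (hα : valid p α) {Γ : Type} [Group Γ]
    {N : Γ → ℝ} (hN : CNorm N) (u : FreeGroup I →* Γ) (v : FreeGroup (Iic (p α).1) →* Γ)
    (huv : ∀ z, u (FreeGroup.map (p α).2.1 z) = v (incl _ z))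
    (hu : ∀ a, N (u a) ≤ NJ p (VS p (Iio α)) a) (hv : ∀ b, N (v b) ≤ (p α).2.2 b) :
    (∀ g, rho (Iio α) g = g → N (u g) ≤ NJ p (VS p (Iic α)) g) ∧
    (∀ w, N (v w) ≤ NJ p (VS p (Iic α)) (emb p α w)) := by
  classical
  have hg := ((valid_iff p α).1 hα).1
  have good := VS_good p (Iic α)
  have good' := VS_good p (Iio α)
  let θ : FreeGroup I →* Γ := FreeGroup.lift (fun γ => if γ = α then
    v (FreeGroup.of ⟨(p α).1, le_rfl⟩) else u (FreeGroup.of γ))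
  have θu : ∀ g, rho (Iio α) g = g → θ g = u g := by
    intro g hg
    have : θ.comp (rho (Iio α)) = u.comp (rho (Iio α)) := by
      ext γ
      by_cases h : γ ∈ Iio α
      · simp [rho_of_mem h, θ, (ne_of_lt h)]
      · simp [rho_of_notMem h]
    have h2 := DFunLike.congr_fun this g
    simpa [hg] using h2
  have θv : ∀ w, θ (emb p α w) = v w := by
    intro w
    have : θ.comp (emb p α) = v := by
      ext γ
      by_cases h : γ.1 < (p α).1
      · have h1 : embV p α γ = (p α).2.1 ⟨γ.1, h⟩ := by simp [embV, h]
        have h2 := huv (FreeGroup.of ⟨γ.1, h⟩)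
        simp only [incl, FreeGroup.map.of] at h2
        simp [emb, h1, θ, (ne_of_lt (hg.2 ⟨γ.1, h⟩)), h2]
      · have h1 : embV p α γ = α := by simp [embV, h]
        have h2 : γ = ⟨(p α).1, le_rfl⟩ := Subtype.ext (le_antisymm γ.2 (not_lt.1 h))
        simp only [MonoidHom.comp_apply, emb, FreeGroup.map.of, h1, θ, FreeGroup.lift_apply_of,
          if_true]
        rw [h2]
    exact DFunLike.congr_fun this w
  have hNθ : CNorm (fun g => N (θ g)) := hN.comap θ
  have adm : ∀ a s, (a, s) ∈ letters p (VS p (Iic α)) → N (θ a) ≤ s := by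
    have kill : ∀ γ, γ ∉ VS p (Iic α) → N (θ (FreeGroup.of γ)) ≤ 0 := by
      intro γ hγ
      have h1 : γ ≠ α := by
        rintro rfl
        exact hγ ⟨le_rfl, hα⟩
      have h2 : γ ∉ VS p (Iio α) := fun h => hγ ⟨le_of_lt h.1, h.2⟩
      have h3 : θ (FreeGroup.of γ) = u (FreeGroup.of γ) := by simp [θ, h1]
      rw [h3]
      exact (hu _).trans (cinf_le (letters_nonneg p _ good')
        (Cost.single (Or.inr ⟨γ, h2, Or.inl rfl⟩)))
    rintro a s (⟨β, hβ, w, h⟩ | ⟨γ, hγ, h | h⟩)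
    · obtain ⟨rfl, rfl⟩ := Prod.mk.inj h
      rcases eq_or_lt_of_le hβ.1 with h1 | h1
      · have h1 : β = α := h1
        subst h1
        rw [θv]; exact hv w
      · rw [θu _ (rho_emb p (good β hβ) (Iic_subset_Iio.2 h1) w)]
        exact (hu _).trans (cinf_le (letters_nonneg p _ good')
          (Cost.single (Or.inl ⟨β, ⟨h1, hβ.2⟩, w, rfl⟩)))
    · obtain ⟨rfl, rfl⟩ := Prod.mk.inj h
      exact kill γ hγ
    · obtain ⟨rfl, rfl⟩ := Prod.mk.inj h
      rw [map_inv, hN.inv]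
      exact kill γ hγ
  constructor
  · intro g hg
    refine le_cinf (letters_total p _ good) fun r hr => ?_
    rw [← θu g hg]
    exact hr.le_of_admissible hNθ adm
  · intro w
    refine le_cinf (letters_total p _ good) fun r hr => ?_
    rw [← θv w]
    exact hr.le_of_admissible hNθ adm

theorem one_step (p : I → Prob I) {α : I} (hα : valid p α) :
    (∀ g, rho (Iio α) g = g → NJ p (VS p (Iio α)) g ≤ NJ p (VS p (Iic α)) g) ∧
    (∀ w, (p α).2.2 w ≤ NJ p (VS p (Iic α)) (emb p α w)) := by
  obtain ⟨hg, hw⟩ := (valid_iff p α).1 hα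
  have hn := NJ_norm p _ (VS_good p (Iio α))
  constructor
  · obtain ⟨Γ, _, N, u, v, hN, h1, h2, h3⟩ :=
      amalgam hn hg.1 (FreeGroup.map (p α).2.1) (incl _) hw
    intro g hg
    rw [← h2]
    exact (one_step_aux p hα hN u v h1 (fun a => (h2 a).le) h3).1 g hg
  · obtain ⟨Γ, _, N, u, v, hN, h1, h2, h3⟩ :=
      amalgam hg.1 hn (incl _) (FreeGroup.map (p α).2.1) (fun z => (hw z).symm)
    intro w
    rw [← h2]
    exact (one_step_aux p hα hN v u (fun z => (h1 z).symm) h3 (fun a => (h2 a).le)).2 w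

theorem one_step' (p : I → Prob I) (α : I) (g) (hg : rho (Iio α) g = g) :
    NJ p (VS p (Iio α)) g ≤ NJ p (VS p (Iic α)) g := by
  by_cases h : valid p α
  · exact (one_step p h).1 g hg
  · have : VS p (Iic α) = VS p (Iio α) := by
      ext β
      refine ⟨fun hβ => ⟨lt_of_le_of_ne hβ.1 ?_, hβ.2⟩, fun hβ => ⟨le_of_lt hβ.1, hβ.2⟩⟩
      rintro rfl
      exact h hβ.2
    rw [this]

theorem cost_max (p : I → Prob I) (D : Set I) (hD : ∀ x ∈ D, Iic x ⊆ D) (d0 : I) (hd0 : d0 ∈ D)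
    (g) (r) (h : Cost (letters p (VS p D)) g r) :
    ∃ δ ∈ D, d0 ≤ δ ∧ Cost (letters p (VS p (Iic δ))) g r := by
  suffices h : ∃ δ ∈ D, ∀ δ' ∈ D, δ ≤ δ' → Cost (letters p (VS p (Iic δ'))) g r by
    obtain ⟨δ, h1, h2⟩ := h
    rcases le_total δ d0 with h3 | h3
    · exact ⟨d0, hd0, le_rfl, h2 d0 hd0 h3⟩
    · exact ⟨δ, h1, h3, h2 δ h1 le_rfl⟩
  induction h with
  | one => exact ⟨d0, hd0, fun _ _ _ => Cost.one⟩
  | mul h s x a t _ ha ih =>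
    obtain ⟨δ, h1, h2⟩ := ih
    rcases ha with ⟨β, hβ, w, hw⟩ | ⟨γ, hγ, hw⟩
    · refine ⟨max β δ, ?_, fun δ' h3 h4 => Cost.mul _ _ _ _ _
        (h2 δ' h3 ((le_max_right _ _).trans h4))
        (Or.inl ⟨β, ⟨(le_max_left _ _).trans h4, hβ.2⟩, w, hw⟩)⟩
      rcases max_choice β δ with h | h
      · rw [h]; exact hβ.1
      · rw [h]; exact h1
    · exact ⟨δ, h1, fun δ' h3 h4 => Cost.mul _ _ _ _ _ (h2 δ' h3 h4)
        (Or.inr ⟨γ, fun h => hγ ⟨hD δ' h3 h.1, h.2⟩, hw⟩)⟩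

theorem main_lower_aux (p : I → Prob I) (α : I) (g) (hg : rho (Iic α) g = g) (γ : I) :
    α ≤ γ → ∀ r, Cost (letters p (VS p (Iic γ))) g r → NJ p (VS p (Iic α)) g ≤ r := by
  induction γ using WellFoundedLT.induction with
  | ind γ ih =>
    intro h r hr
    have hr' := cinf_le (letters_nonneg p _ (VS_good p _)) hr
    rcases eq_or_lt_of_le h with rfl | h
    · exact hr'
    · refine le_trans ?_ ((one_step' p γ g (rho_mono (Iic_subset_Iio.2 h) hg)).trans hr')
      refine le_cinf (letters_total p _ (VS_good p _)) fun s hs => ?_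
      obtain ⟨δ, h1, h2, h3⟩ := cost_max p (Iio γ) (fun x hx => Iic_subset_Iio.2 hx) α h g s hs
      exact ih δ h1 h2 s h3

theorem main_lower (p : I → Prob I) (α : I) (g) (hg : rho (Iic α) g = g) :
    NJ p (VS p (Iic α)) g ≤ NJ p (VS p univ) g := by
  refine le_cinf (letters_total p _ (VS_good p _)) fun s hs => ?_
  obtain ⟨δ, h1, h2, h3⟩ := cost_max p univ (fun x hx => subset_univ _) α trivial g s hs
  exact main_lower_aux p α g hg δ h2 s h3

theorem main_upper (p : I → Prob I) (α : I) (g) (hg : rho (Iio α) g = g) :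
    NJ p (VS p univ) g ≤ NJ p (VS p (Iio α)) g := by
  refine le_cinf (letters_total p _ (VS_good p _)) fun s hs => ?_
  refine cinf_le (letters_nonneg p _ (VS_good p _)) ?_
  rw [← hg]
  clear hg
  induction hs with
  | one => simpa using Cost.one
  | mul h s x a t _ ha ih =>
    have key : (rho (Iio α) a, t) ∈ letters p (VS p univ) ∨ (rho (Iio α) a = 1 ∧ t = 0) := by
      rcases ha with ⟨β, hβ, w, hw⟩ | ⟨γ, hγ, hw⟩
      · obtain ⟨rfl, rfl⟩ := Prod.mk.inj hw
        rw [rho_emb p (VS_good p _ β hβ) (Iic_subset_Iio.2 hβ.1)]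
        exact Or.inl (Or.inl ⟨β, ⟨trivial, hβ.2⟩, w, rfl⟩)
      · by_cases h1 : γ ∈ Iio α
        · left
          have h2 : γ ∉ VS p univ := fun h => hγ ⟨h1, h.2⟩
          rcases hw with hw | hw
          · obtain ⟨rfl, rfl⟩ := Prod.mk.inj hw
            rw [rho_of_mem h1]
            exact Or.inr ⟨γ, h2, Or.inl rfl⟩
          · obtain ⟨rfl, rfl⟩ := Prod.mk.inj hw
            rw [map_inv, rho_of_mem h1]
            exact Or.inr ⟨γ, h2, Or.inr rfl⟩
        · right
          rcases hw with hw | hw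
          · obtain ⟨rfl, rfl⟩ := Prod.mk.inj hw
            exact ⟨rho_of_notMem h1, rfl⟩
          · obtain ⟨rfl, rfl⟩ := Prod.mk.inj hw
            rw [map_inv, rho_of_notMem h1]
            exact ⟨inv_one, rfl⟩
    rw [map_mul, map_mul, map_mul, map_inv]
    rcases key with hk | ⟨h1, h2⟩
    · exact Cost.mul _ _ _ _ _ ih hk
    · rw [h1, h2]
      simpa using ih

theorem main_eq (p : I → Prob I) (α : I) (g) (hg : rho (Iio α) g = g) :
    NJ p (VS p (Iio α)) g = NJ p (VS p univ) g :=
  le_antisymm ((one_step' p α g hg).trans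
    (main_lower p α g (rho_mono Iio_subset_Iic_self hg))) (main_upper p α g hg)

theorem main_val (p : I → Prob I) {α : I} (hα : valid p α) (w) :
    NJ p (VS p univ) (emb p α w) = (p α).2.2 w := by
  refine le_antisymm ?_ ?_
  · exact cinf_le (letters_nonneg p _ (VS_good p _))
      (Cost.single (Or.inl ⟨α, ⟨trivial, hα⟩, w, rfl⟩))
  · exact ((one_step p hα).2 w).trans
      (main_lower p α _ (rho_emb p ((valid_iff p α).1 hα).1 le_rfl w))

/-- The universal property. -/
theorem universal_map (p : I → Prob I)
    (hp : ∀ (β : I) (e : Iio β → I) (l : FreeGroup (Iic β) → ℝ),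
      ∃ α, (∀ γ, e γ < α) ∧ p α = ⟨β, e, l⟩)
    {H : Type} [Group H] (nH : H → ℝ) (hH : CNorm nH) (h : I → H) :
    ∃ f : I → I, ∀ w, NJ p (VS p univ) (FreeGroup.map f w) = nH (FreeGroup.lift h w) := by
  let L : ∀ β : I, FreeGroup (Iic β) → ℝ := fun β w => nH (FreeGroup.lift (fun γ => h γ.1) w)
  choose a ha1 ha2 using hp
  let f : I → I := (wellFounded_lt (α := I)).fix
    (fun β ih => a β (fun γ => ih γ.1 γ.2) (L β))
  have hf : ∀ β, f β = a β (fun γ => f γ.1) (L β) := fun β => by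
    simp only [f]
    rw [WellFounded.fix_eq]
  have hf1 : ∀ β γ, γ < β → f γ < f β := fun β γ hγ => by
    rw [hf β]
    exact ha1 β (fun γ => f γ.1) (L β) ⟨γ, hγ⟩
  have hf2 : ∀ β, p (f β) = ⟨β, fun γ => f γ.1, L β⟩ := fun β => by
    rw [hf β]
    exact ha2 β (fun γ => f γ.1) (L β)
  have hn := NJ_norm p _ (VS_good p univ)
  have key : ∀ β w, rho (Iic β) w = w →
      NJ p (VS p univ) (FreeGroup.map f w) = nH (FreeGroup.lift h w) := by
    intro β
    induction β using WellFoundedLT.induction with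
    | ind β ih =>
      have ih' : ∀ w, rho (Iio β) w = w →
          NJ p (VS p univ) (FreeGroup.map f w) = nH (FreeGroup.lift h w) := by
        intro w hw
        rcases rho_fin (Iio β) w with h1 | ⟨γ, h1, h2⟩
        · rw [← hw, h1]; simp [hn.one, hH.one]
        · rw [hw] at h2
          exact ih γ h1 w h2
      have gen : ∀ α (_ : p α = ⟨β, fun γ => f γ.1, L β⟩) (_ : ∀ γ < β, f γ < α),
          valid p α ∧ ∀ w : FreeGroup (Iic β), NJ p (VS p univ)
            (FreeGroup.map (fun γ => if γ.1 < β then f γ.1 else α) w) = L β w := by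
        intro α h1 h2
        have hv : valid p α := by
          rw [valid_iff]
          unfold GoodIdx
          rw [h1]
          refine ⟨⟨hH.comap _, fun γ => h2 γ.1 γ.2⟩, fun w => ?_⟩
          simp only
          rw [main_eq p α _ (rho_map _ (fun γ => h2 γ.1 γ.2) w)]
          have h3 := ih' (FreeGroup.map Subtype.val w) (rho_map _ (fun γ => γ.2) w)
          rw [FreeGroup.map.comp] at h3
          have h4 : FreeGroup.lift h (FreeGroup.map Subtype.val w) =
              FreeGroup.lift (fun γ : Iic β => h γ.1) (incl β w) := by
            have : (FreeGroup.lift h).comp (FreeGroup.map (Subtype.val : Iio β → I)) =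
              (FreeGroup.lift (fun γ : Iic β => h γ.1)).comp (incl β) := by
              ext γ; simp [incl]
            exact DFunLike.congr_fun this w
          rw [h4] at h3
          exact h3
        refine ⟨hv, ?_⟩
        have h5 := main_val p hv
        unfold emb embV at h5
        rw [h1] at h5
        simpa using h5
      intro w hw
      have h6 := (gen (f β) (hf2 β) (fun γ hγ => hf1 β γ hγ)).2
      have h7 : (fun γ : Iic β => if γ.1 < β then f γ.1 else f β) = fun γ => f γ.1 := by
        funext γ
        split_ifs with h8
        · rfl
        · rw [le_antisymm γ.2 (not_lt.1 h8)]
      rw [h7] at h6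
      have h9 : ∃ w' : FreeGroup (Iic β), FreeGroup.map Subtype.val w' = w := by
        classical
        let q : FreeGroup I →* FreeGroup (Iic β) := FreeGroup.lift
          (fun γ => if hγ : γ ≤ β then FreeGroup.of ⟨γ, hγ⟩ else 1)
        refine ⟨q w, ?_⟩
        have : (FreeGroup.map (Subtype.val : Iic β → I)).comp q = rho (Iic β) := by
          ext γ
          by_cases hγ : γ ≤ β
          · simp [q, hγ, rho]
          · simp [q, hγ, rho]
        rw [← hw]
        conv_rhs => rw [← this]
        rw [hw]
        rfl
      obtain ⟨w', rfl⟩ := h9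
      rw [FreeGroup.map.comp]
      refine (h6 w').trans ?_
      have : (FreeGroup.lift h).comp (FreeGroup.map (Subtype.val : Iic β → I)) =
          FreeGroup.lift (fun γ : Iic β => h γ.1) := by
        ext γ; simp
      change nH _ = nH _
      rw [← this]
      rfl
  refine ⟨f, fun w => ?_⟩
  have e : rho univ w = w := by
    have : rho (univ : Set I) = MonoidHom.id _ := by
      ext γ; simp [rho]
    rw [this]; rfl
  rcases rho_fin univ w with h1 | ⟨γ, -, h2⟩
  · rw [← e, h1]; simp [hn.one, hH.one]
  · rw [e] at h2
    exact key γ w h2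

end Universal

section Bookkeeping

open Cardinal Set

theorem pow_le_of_powerlt {κ μ : Cardinal.{0}} (hpow : κ ^< κ = κ) (h : μ < κ) : κ ^ μ ≤ κ :=
  (le_powerlt κ h).trans hpow.le

theorem exists_bound {κ : Cardinal.{0}} (hκ : ℵ₀ < κ) (hpow : κ ^< κ = κ)
    (β : κ.ord.ToType) (e : Iio β → κ.ord.ToType) : ∃ α, ∀ γ, e γ < α := by
  by_contra hcon
  push Not at hcon
  have hcof : IsCofinal (range e) := fun α => by
    obtain ⟨γ, hγ⟩ := hcon α
    exact ⟨e γ, ⟨γ, rfl⟩, hγ⟩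
  have h1 : Order.cof κ.ord.ToType ≤ #(range e) := Order.cof_le hcof
  rw [Ordinal.cof_toType] at h1
  have h2 : κ.ord.cof < κ := (h1.trans mk_range_le).trans_lt (mk_Iio_toType_ord_lt β)
  exact (lt_power_cof_ord hκ.le).not_ge (pow_le_of_powerlt hpow h2)

theorem continuum_le {κ : Cardinal.{0}} (hκ : ℵ₀ < κ) (hpow : κ ^< κ = κ) : #ℝ ≤ κ := by
  rw [mk_real, ← two_power_aleph0]
  refine le_trans ?_ (pow_le_of_powerlt hpow hκ)
  exact power_le_power_right ((nat_lt_aleph0 2).le.trans hκ.le)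

theorem mk_Prob_le {κ : Cardinal.{0}} (hκ : ℵ₀ < κ) (hpow : κ ^< κ = κ) :
    #(Prob κ.ord.ToType) ≤ κ := by
  have hI : #κ.ord.ToType = κ := mk_ord_toType κ
  rw [Prob, mk_sigma]
  refine (sum_le_sum _ (fun _ => κ) ?_).trans ?_
  · intro β
    have h1 : #(Iio β) < κ := mk_Iio_toType_ord_lt β
    have h2 : #(Iic β) < κ := by
      rw [← Iio_insert]
      exact mk_insert_le.trans_lt (add_lt_of_lt hκ.le h1 (one_lt_aleph0.trans hκ))
    have h3 : #(FreeGroup (Iic β)) < κ := by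
      haveI : Nonempty (Iic β) := ⟨⟨β, mem_Iic.2 le_rfl⟩⟩
      rw [mk_freeGroup]
      exact max_lt h2 hκ
    rw [mk_prod, lift_id, lift_id, ← power_def, ← power_def, hI]
    refine (mul_le_mul' (pow_le_of_powerlt hpow h1) ((power_le_power_right
      (continuum_le hκ hpow)).trans (pow_le_of_powerlt hpow h3))).trans ?_
    rw [mul_eq_self hκ.le]
  · rw [sum_const', hI, mul_eq_self hκ.le]

theorem exists_bookkeeping {κ : Cardinal.{0}} (hκ : ℵ₀ < κ) (hpow : κ ^< κ = κ) :
    ∃ p : κ.ord.ToType → Prob κ.ord.ToType,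
      ∀ (β : κ.ord.ToType) (e : Iio β → κ.ord.ToType) (l : FreeGroup (Iic β) → ℝ),
        ∃ α, (∀ γ, e γ < α) ∧ p α = ⟨β, e, l⟩ := by
  have hI : #κ.ord.ToType = κ := mk_ord_toType κ
  have hne : Nonempty κ.ord.ToType := by
    rw [← mk_ne_zero_iff, hI]
    exact (aleph0_pos.trans hκ).ne'
  obtain ⟨i0⟩ := hne
  have hle : #(Prob κ.ord.ToType × κ.ord.ToType) ≤ #κ.ord.ToType := by
    rw [mk_prod, lift_id, lift_id, hI]
    exact (mul_le_mul' (mk_Prob_le hκ hpow) le_rfl).trans (mul_eq_self hκ.le).le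
  obtain ⟨j⟩ := hle
  haveI : Nonempty (Prob κ.ord.ToType × κ.ord.ToType) :=
    ⟨(⟨i0, fun _ => i0, fun _ => 0⟩, i0)⟩
  refine ⟨fun α => (Function.invFun j α).1, fun β e l => ?_⟩
  obtain ⟨b, hb⟩ := exists_bound hκ hpow β e
  let g : κ.ord.ToType → κ.ord.ToType := fun i => j (⟨β, e, l⟩, i)
  have hg : Function.Injective g := fun x y hxy => by
    have := j.injective hxy
    exact (Prod.ext_iff.1 this).2
  have : ∃ i, b ≤ g i := by
    by_contra hcon
    push Not at hcon
    have h1 : #κ.ord.ToType ≤ #(Iio b) :=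
      mk_le_of_injective (f := fun i => (⟨g i, hcon i⟩ : Iio b))
        (fun x y hxy => hg (Subtype.ext_iff.1 hxy))
    rw [hI] at h1
    exact h1.not_gt (mk_Iio_toType_ord_lt b)
  obtain ⟨i, hi⟩ := this
  refine ⟨g i, fun γ => (hb γ).trans_le hi, ?_⟩
  change (Function.invFun j (j (⟨β, e, l⟩, i))).1 = _
  rw [Function.leftInverse_invFun j.injective]

theorem mk_le_of_dense {κ : Cardinal.{0}} (hκ : ℵ₀ < κ) (hpow : κ ^< κ = κ)
    {H : Type} [MetricSpace H] (t : Set H) (ht : Dense t) (htκ : #t ≤ κ) : #H ≤ κ := by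
  have hex : ∀ (x : H) (n : ℕ), ∃ y : t, dist x y < 1 / ((n : ℝ) + 1) := fun x n => by
    obtain ⟨y, hy, h⟩ := ht.exists_dist_lt x (Nat.one_div_pos_of_nat (n := n) (α := ℝ))
    exact ⟨⟨y, hy⟩, h⟩
  choose s hs using hex
  have hinj : Function.Injective s := fun x y hxy => by
    refine eq_of_forall_dist_le fun ε hε => ?_
    obtain ⟨n, hn⟩ := exists_nat_one_div_lt (half_pos hε)
    have h1 := hs x n
    have h2 := hs y n
    rw [← hxy] at h2
    have := dist_triangle_right x y (s x n)
    linarith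
  refine (mk_le_of_injective hinj).trans ?_
  rw [← power_def, mk_nat]
  exact (power_le_power_right htκ).trans (pow_le_of_powerlt hpow hκ)

end Bookkeeping

section Completed

/-- A type synonym of an additive group, to be metrized by a seminorm. -/
def NGroup {F : Type} [Group F] (N : F → ℝ) (_ : CNorm N) : Type := Additive F

variable {F : Type} [Group F] {N : F → ℝ} {hN : CNorm N}

instance : AddGroup (NGroup N hN) := inferInstanceAs (AddGroup (Additive F))

/-- The inclusion. -/
def NGroup.mk (x : F) : NGroup N hN := Additive.ofMul x

/-- The value of the seminorm. -/
def NGroup.nrm (x : NGroup N hN) : ℝ := N (Additive.toMul (α := F) x)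

theorem NGroup.nrm_add (x y : NGroup N hN) : (x + y).nrm ≤ x.nrm + y.nrm := hN.mul _ _

theorem NGroup.nrm_neg (x : NGroup N hN) : (-x).nrm = x.nrm := hN.inv _

theorem NGroup.nrm_conj (x y : NGroup N hN) : (x + y + -x).nrm = y.nrm := hN.conj _ _

theorem NGroup.nrm_zero : (0 : NGroup N hN).nrm = 0 := hN.one

noncomputable instance : PseudoMetricSpace (NGroup N hN) where
  dist x y := (-x + y).nrm
  dist_self x := by
    change (-x + x).nrm = 0
    rw [neg_add_cancel]; exact NGroup.nrm_zero
  dist_comm x y := by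
    change (-x + y).nrm = (-y + x).nrm
    rw [← NGroup.nrm_neg, neg_add_rev, neg_neg]
  dist_triangle x y z := by
    change (-x + z).nrm ≤ (-x + y).nrm + (-y + z).nrm
    have h := NGroup.nrm_add (-x + y) (-y + z)
    rwa [add_assoc, add_neg_cancel_left] at h

theorem NGroup.dist_def (x y : NGroup N hN) : dist x y = (-x + y).nrm := rfl

theorem NGroup.dist_left (g x y : NGroup N hN) : dist (g + x) (g + y) = dist x y := by
  rw [NGroup.dist_def, NGroup.dist_def, neg_add_rev, add_assoc, neg_add_cancel_left]

theorem NGroup.dist_right (g x y : NGroup N hN) : dist (x + g) (y + g) = dist x y := by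
  rw [NGroup.dist_def, NGroup.dist_def, neg_add_rev, ← NGroup.nrm_conj (-g) (-x + y)]
  simp only [add_assoc, neg_neg]

instance : IsUniformAddGroup (NGroup N hN) := by
  refine ⟨?_⟩
  rw [Metric.uniformContinuous_iff]
  intro ε hε
  refine ⟨ε / 2, half_pos hε, ?_⟩
  rintro ⟨a, b⟩ ⟨c, d⟩ h
  have h1 : dist a c < ε / 2 := (le_max_left _ _).trans_lt h
  have h2 : dist b d < ε / 2 := (le_max_right _ _).trans_lt h
  have h3 : dist (-b) (-d) = dist b d := by
    rw [← NGroup.dist_left b, ← NGroup.dist_right d]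
    simp [dist_comm]
  have h4 := dist_triangle (a + -b) (c + -b) (c + -d)
  rw [NGroup.dist_right, NGroup.dist_left, h3] at h4
  change dist (a - b) (c - d) < ε
  rw [sub_eq_add_neg, sub_eq_add_neg]
  linarith

open UniformSpace in
theorem exists_completed_group (F : Type) [Group F] (N : F → ℝ) (hN : CNorm N) :
    ∃ (G : Type) (_ : Group G) (_ : MetricSpace G) (c : F →* G),
      BiInvariantDist G ∧ CompleteSpace G ∧ DenseRange c ∧ ∀ x, dist (c x) 1 = N x := by
  let A := NGroup N hN
  have hl : ∀ g x y : Completion A, dist (g + x) (g + y) = dist x y := fun g x y => by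
    refine Completion.induction_on₃ g x y
      (isClosed_eq (by fun_prop) (by fun_prop)) fun a b c => ?_
    rw [← Completion.coe_add, ← Completion.coe_add, Completion.dist_eq, Completion.dist_eq,
      NGroup.dist_left]
  have hr : ∀ g x y : Completion A, dist (x + g) (y + g) = dist x y := fun g x y => by
    refine Completion.induction_on₃ g x y
      (isClosed_eq (by fun_prop) (by fun_prop)) fun a b c => ?_
    rw [← Completion.coe_add, ← Completion.coe_add, Completion.dist_eq, Completion.dist_eq,
      NGroup.dist_right]
  let c : F →* Multiplicative (Completion A) :=
    { toFun := fun x => Multiplicative.ofAdd ((NGroup.mk (hN := hN) x : A) : Completion A)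
      map_one' := rfl
      map_mul' := fun x y => congrArg Multiplicative.ofAdd
        (Completion.coe_add (NGroup.mk (hN := hN) x) (NGroup.mk (hN := hN) y)) }
  refine ⟨Multiplicative (Completion A), inferInstance,
    inferInstanceAs (MetricSpace (Completion A)), c, fun g x y => ⟨hl g x y, hr g x y⟩,
    inferInstanceAs (CompleteSpace (Completion A)), ?_, fun x => ?_⟩
  · exact Completion.denseRange_coe (α := A)
  · have h1 : dist ((NGroup.mk (hN := hN) x : A) : Completion A) ((0 : A) : Completion A)
        = dist (NGroup.mk (hN := hN) x) (0 : A) := Completion.dist_eq _ _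
    refine h1.trans ?_
    rw [dist_comm, NGroup.dist_def, neg_zero, zero_add]
    rfl

end Completed

theorem BiInvariantDist.dist_eq {G : Type} [Group G] [MetricSpace G] (hG : BiInvariantDist G)
    (x y : G) : dist x y = dist (y⁻¹ * x) 1 := by
  rw [← (hG y⁻¹ x y).1, inv_mul_cancel]

theorem BiInvariantDist.cnorm {G : Type} [Group G] [MetricSpace G] (hG : BiInvariantDist G) :
    CNorm (fun x : G => dist x 1) where
  one := dist_self _
  mul g h := by
    have h1 := dist_triangle (g * h) g 1
    have h2 := (hG g h 1).1
    rw [mul_one] at h2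
    linarith
  inv g := by
    have h2 := (hG g g⁻¹ 1).1
    rw [mul_one, mul_inv_cancel] at h2
    rw [← h2, dist_comm]
  conj x g := by
    have h2 := (hG x⁻¹ (x * g) x).2
    have h3 := (hG x g 1).1
    rw [mul_inv_cancel] at h2
    rw [mul_one] at h3
    rw [h2, h3]

theorem exists_embedding {G H F : Type} [Group G] [MetricSpace G] [Group H] [MetricSpace H]
    [Group F] (hG : BiInvariantDist G) (hH : BiInvariantDist H) (ψ : F →* G) (q : F →* H)
    (hq : Function.Surjective q) (h : ∀ w, dist (ψ w) 1 = dist (q w) 1) :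
    ∃ f : H →* G, Function.Injective f ∧ Isometry f := by
  have hd : ∀ v w, dist (ψ v) (ψ w) = dist (q v) (q w) := fun v w => by
    rw [hG.dist_eq, hH.dist_eq, ← map_inv, ← map_inv, ← map_mul, ← map_mul, h]
  have he : ∀ v w, q v = q w → ψ v = ψ w := fun v w hvw => by
    rw [← dist_eq_zero, hd, hvw, dist_self]
  choose σ hσ using hq
  let f : H →* G :=
    { toFun := fun x => ψ (σ x)
      map_one' := by rw [← map_one ψ]; exact he _ _ (by rw [hσ, map_one])
      map_mul' := fun x y => by rw [← map_mul]; exact he _ _ (by rw [hσ, map_mul, hσ, hσ]) }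
  have hf : Isometry f := Isometry.of_dist_eq fun x y => by
    change dist (ψ (σ x)) (ψ (σ y)) = _
    rw [hd, hσ, hσ]
  exact ⟨f, hf.injective, hf⟩

/-- If `κ` is an uncountable cardinal with `κ^{<κ} = κ`, then there is a
group with complete bi-invariant metric and density character at most `κ` into which every
group with bi-invariant metric of density at most `κ` embeds isometrically. -/
theorem exists_metrically_universal_group_of_density (κ : Cardinal)
    (hκ : Cardinal.aleph0 < κ) (hpow : κ ^< κ = κ) :
    ∃ (G : Type) (_ : Group G) (_ : MetricSpace G),
      BiInvariantDist G ∧ CompleteSpace G ∧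
      (∃ s : Set G, Dense s ∧ Cardinal.mk s ≤ κ) ∧
      ∀ (H : Type) (_ : Group H) (_ : MetricSpace H),
        BiInvariantDist H → (∃ t : Set H, Dense t ∧ Cardinal.mk t ≤ κ) →
        ∃ f : H →* G, Function.Injective f ∧ Isometry f := by
  obtain ⟨p, hp⟩ := exists_bookkeeping hκ hpow
  have hI : Cardinal.mk κ.ord.ToType = κ := Cardinal.mk_ord_toType κ
  have hne : Nonempty κ.ord.ToType := by
    rw [← Cardinal.mk_ne_zero_iff, hI]
    exact (Cardinal.aleph0_pos.trans hκ).ne'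
  obtain ⟨G, iG, mG, c, hG, hcomp, hdense, hc⟩ := exists_completed_group
    (FreeGroup κ.ord.ToType) (NJ p (VS p Set.univ)) (NJ_norm p (VS p Set.univ) (VS_good p Set.univ))
  refine ⟨G, iG, mG, hG, hcomp, ⟨Set.range c, hdense, ?_⟩, ?_⟩
  · refine Cardinal.mk_range_le.trans ?_
    rw [Cardinal.mk_freeGroup, hI]
    exact max_le le_rfl hκ.le
  · rintro H iH mH hH ⟨t, ht, htκ⟩
    have hHκ : Cardinal.mk H ≤ Cardinal.mk κ.ord.ToType := by
      rw [hI]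
      exact mk_le_of_dense hκ hpow t ht htκ
    obtain ⟨j⟩ := hHκ
    have hsurj : Function.Surjective (Function.invFun j) := Function.invFun_surjective j.injective
    obtain ⟨f, hf⟩ := universal_map p hp (fun x : H => dist x 1) hH.cnorm (Function.invFun j)
    refine exists_embedding hG hH (c.comp (FreeGroup.map f)) (FreeGroup.lift (Function.invFun j))
      ?_ ?_
    · intro x
      obtain ⟨i, hi⟩ := hsurj x
      exact ⟨FreeGroup.of i, by rw [FreeGroup.lift_apply_of, hi]⟩
    · intro w
      rw [MonoidHom.comp_apply, hc, hf]
end
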